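/- Let u be a positive singular solution of (-Δ)³u = c_n·u^{(n+6)/(n-6)} on ℝⁿ\{0}. Then u is radially symmetric with respect to the origin: u(x) = u(y) for all nonzero x, y ∈ ℝⁿ with |x| = |y|. -/

import Mathlib

noncomputable section

open Real

/-- The Euclidean Laplacian: the sum of the second partial derivatives. -/
def laplacian {n : ℕ} (u : EuclideanSpace ℝ (Fin n) → ℝ) (x : EuclideanSpace ℝ (Fin n)) : ℝ :=
  ∑ i : Fin n, iteratedFDeriv ℝ 2 u x ![EuclideanSpace.single i 1, EuclideanSpace.single i 1]

def cN (n : ℕ) : ℝ := (n : ℝ) * ((n : ℝ) - 6) * ((n : ℝ) ^ 4 - 20 * (n : ℝ) ^ 2 + 64) / 64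

section

open MeasureTheory Set Filter Topology Metric Module

section RieszKernel

variable {E : Type*} [NormedAddCommGroup E] [InnerProductSpace ℝ E] [FiniteDimensional ℝ E]
  [MeasurableSpace E] [BorelSpace E] {k : ℕ}

lemma exists_riesz_kernel_mass (hE : finrank ℝ E = k + 6) : ∃ A : ℝ, 0 ≤ A ∧
    (∀ δ : ℝ, 0 < δ → IntegrableOn (fun w : E => (‖w‖ ^ k)⁻¹) (ball 0 δ) ∧
      ∫ w in ball (0 : E) δ, (‖w‖ ^ k)⁻¹ = A * δ ^ 6) ∧
    (∀ R : ℝ, 0 < R → IntegrableOn (fun w : E => (‖w‖ ^ (k + 12))⁻¹) (ball 0 R)ᶜ ∧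
      ∫ w in (ball (0 : E) R)ᶜ, (‖w‖ ^ (k + 12))⁻¹ = A * (R ^ 6)⁻¹) := by
  have : Nontrivial E := Module.nontrivial_of_finrank_pos (R := ℝ) (by omega)
  refine ⟨finrank ℝ E * volume.real (ball (0 : E) 1) / 6, by positivity, fun δ hδ => ?_,
    fun R hR => ?_⟩
  · have hball : (ball (0 : E) δ).indicator (fun w : E => (‖w‖ ^ k)⁻¹) =
        fun w => (Iio δ).indicator (fun t : ℝ => (t ^ k)⁻¹) ‖w‖ := by
      ext w; simp [indicator]
    have hone : (fun y : ℝ => y ^ (finrank ℝ E - 1) • (Iio δ).indicator (fun t : ℝ => (t ^ k)⁻¹) y)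
        =ᵐ[volume.restrict (Ioi 0)] (Iio δ).indicator (fun y => y ^ 5) := by
      filter_upwards [ae_restrict_mem measurableSet_Ioi] with y hy
      have hy : (0 : ℝ) < y := hy
      by_cases h : y ∈ Iio δ
      · simp only [indicator_of_mem h, hE, smul_eq_mul]
        rw [show k + 6 - 1 = 5 + k by omega, pow_add]
        field_simp
      · simp [indicator_of_notMem h]
    have hset : Ioi (0 : ℝ) ∩ Iio δ = Ioo 0 δ := by ext; simp
    rw [← integrable_indicator_iff measurableSet_ball, ← integral_indicator measurableSet_ball,
      hball, integrable_fun_norm_addHaar volume, integral_fun_norm_addHaar volume, IntegrableOn,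
      integrable_congr hone, integral_congr_ae hone, integral_indicator measurableSet_Iio,
      Measure.restrict_restrict measurableSet_Iio, integrable_indicator_iff measurableSet_Iio,
      IntegrableOn, Measure.restrict_restrict measurableSet_Iio, inter_comm, hset,
      ← integral_Ioc_eq_integral_Ioo, ← intervalIntegral.integral_of_le hδ.le, integral_pow]
    refine ⟨?_, by simp; ring⟩
    exact ((continuous_pow 5).integrableOn_Icc (a := 0) (b := δ)).mono_set Ioo_subset_Icc_self
  · have hball : (ball (0 : E) R)ᶜ.indicator (fun w : E => (‖w‖ ^ (k + 12))⁻¹) =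
        fun w => (Ici R).indicator (fun t : ℝ => (t ^ (k + 12))⁻¹) ‖w‖ := by
      ext w; simp [indicator]
    have hone : (fun y : ℝ => y ^ (finrank ℝ E - 1) •
          (Ici R).indicator (fun t : ℝ => (t ^ (k + 12))⁻¹) y)
        =ᵐ[volume.restrict (Ioi 0)] (Ici R).indicator (fun y => y ^ (-7 : ℝ)) := by
      filter_upwards [ae_restrict_mem measurableSet_Ioi] with y hy
      have hy : (0 : ℝ) < y := hy
      by_cases h : y ∈ Ici R
      · simp only [indicator_of_mem h, hE, smul_eq_mul]
        rw [show k + 6 - 1 = k + 5 by omega, rpow_neg hy.le,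
          show (7 : ℝ) = ((7 : ℕ) : ℝ) by norm_num, rpow_natCast,
          show k + 12 = (k + 5) + 7 by omega, pow_add y (k + 5) 7]
        field_simp
      · simp [indicator_of_notMem h]
    have hset : Ioi (0 : ℝ) ∩ Ici R = Ici R := inter_eq_right.2 fun y hy => hR.trans_le hy
    rw [← integrable_indicator_iff measurableSet_ball.compl,
      ← integral_indicator measurableSet_ball.compl,
      hball, integrable_fun_norm_addHaar volume, integral_fun_norm_addHaar volume, IntegrableOn,
      integrable_congr hone, integral_congr_ae hone, integral_indicator measurableSet_Ici,
      Measure.restrict_restrict measurableSet_Ici, integrable_indicator_iff measurableSet_Ici,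
      IntegrableOn, Measure.restrict_restrict measurableSet_Ici, inter_comm, hset,
      integral_Ici_eq_integral_Ioi, integral_Ioi_rpow_of_lt (by norm_num) hR]
    refine ⟨?_, ?_⟩
    · have := integrableOn_Ioi_rpow_of_lt (a := -7) (by norm_num) hR
      rwa [← integrableOn_Ici_iff_integrableOn_Ioi] at this
    · rw [show (-7 + 1 : ℝ) = -((6 : ℕ) : ℝ) by norm_num, rpow_neg hR.le, rpow_natCast]
      simp
      ring

lemma inv_pow_mul_inv_pow_le {a b : ℝ} (ha : 0 < a) (hb : 0 < b) (k : ℕ) :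
    (a ^ k)⁻¹ * (b ^ 12)⁻¹ ≤ (a ^ (k + 12))⁻¹ + (b ^ (k + 12))⁻¹ := by
  rcases le_total a b with h | h
  · have : (a ^ k)⁻¹ * (b ^ 12)⁻¹ ≤ (a ^ (k + 12))⁻¹ := by
      rw [pow_add, mul_inv]; gcongr
    have : 0 < (b ^ (k + 12))⁻¹ := by positivity
    linarith
  · have : (a ^ k)⁻¹ * (b ^ 12)⁻¹ ≤ (b ^ (k + 12))⁻¹ := by
      rw [pow_add, mul_inv]; gcongr
    have : 0 < (a ^ (k + 12))⁻¹ := by positivity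
    linarith

lemma integrableOn_sub_iff {f : E → ℝ} {s : Set E} (y : E) :
    IntegrableOn (fun z => f (z - y)) ((fun z => z - y) ⁻¹' s) ↔ IntegrableOn f s :=
  (measurePreserving_sub_right volume y).integrableOn_comp_preimage
    (MeasurableEquiv.subRight y).measurableEmbedding

lemma setIntegral_sub {f : E → ℝ} {s : Set E} (y : E) :
    ∫ z in (fun z => z - y) ⁻¹' s, f (z - y) = ∫ z in s, f z :=
  (measurePreserving_sub_right volume y).setIntegral_preimage_emb
    (MeasurableEquiv.subRight y).measurableEmbedding _ _

/-- Uniform smallness of the Riesz potential of the tail of `‖z - c‖⁻¹²` and of small balls. -/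
lemma exists_riesz_potential_bound (hE : finrank ℝ E = k + 6) : ∃ A : ℝ, 0 ≤ A ∧
    (∀ (y : E) (δ : ℝ), 0 < δ → IntegrableOn (fun z : E => (‖y - z‖ ^ k)⁻¹) (ball y δ) ∧
      ∫ z in ball y δ, (‖y - z‖ ^ k)⁻¹ ≤ A * δ ^ 6) ∧
    (∀ (y c : E) (R : ℝ), 0 < R →
      IntegrableOn (fun z : E => (‖y - z‖ ^ k)⁻¹ * (‖z - c‖ ^ 12)⁻¹) (ball c R)ᶜ ∧
      ∫ z in (ball c R)ᶜ, (‖y - z‖ ^ k)⁻¹ * (‖z - c‖ ^ 12)⁻¹ ≤ A * (R ^ 6)⁻¹) := by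
  obtain ⟨A, hA, hin, hout⟩ := exists_riesz_kernel_mass (E := E) hE
  have hpre (y : E) (δ : ℝ) : (fun z => z - y) ⁻¹' (ball 0 δ) = ball y δ := by
    ext z; simp [dist_eq_norm]
  have hpre' (y : E) (δ : ℝ) : (fun z => z - y) ⁻¹' (ball 0 δ)ᶜ = (ball y δ)ᶜ := by
    rw [preimage_compl, hpre]
  have hin' (y : E) (δ : ℝ) (hδ : 0 < δ) :
      IntegrableOn (fun z : E => (‖y - z‖ ^ k)⁻¹) (ball y δ) ∧
      ∫ z in ball y δ, (‖y - z‖ ^ k)⁻¹ = A * δ ^ 6 := by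
    simp_rw [norm_sub_rev y]
    rw [← hpre, integrableOn_sub_iff (f := fun w : E => (‖w‖ ^ k)⁻¹),
      setIntegral_sub (f := fun w : E => (‖w‖ ^ k)⁻¹)]
    exact hin δ hδ
  have hout' (y : E) (δ : ℝ) (hδ : 0 < δ) :
      IntegrableOn (fun z : E => (‖z - y‖ ^ (k + 12))⁻¹) (ball y δ)ᶜ ∧
      ∫ z in (ball y δ)ᶜ, (‖z - y‖ ^ (k + 12))⁻¹ = A * (δ ^ 6)⁻¹ := by
    rw [← hpre', integrableOn_sub_iff (f := fun w : E => (‖w‖ ^ (k + 12))⁻¹),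
      setIntegral_sub (f := fun w : E => (‖w‖ ^ (k + 12))⁻¹)]
    exact hout δ hδ
  refine ⟨3 * A, by positivity, fun y δ hδ => ⟨(hin' y δ hδ).1, ?_⟩, fun y c R hR => ?_⟩
  · rw [(hin' y δ hδ).2]
    have : 0 ≤ A * δ ^ 6 := by positivity
    linarith
  · set f₁ : E → ℝ := (ball y R).indicator fun z => (R ^ 12)⁻¹ * (‖y - z‖ ^ k)⁻¹
    set f₂ : E → ℝ := (ball y R)ᶜ.indicator fun z => (‖z - y‖ ^ (k + 12))⁻¹
    set f₃ : E → ℝ := (ball c R)ᶜ.indicator fun z => (‖z - c‖ ^ (k + 12))⁻¹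
    have i₁ : Integrable f₁ :=
      (integrable_indicator_iff measurableSet_ball).2 ((hin' y R hR).1.const_mul _)
    have i₂ : Integrable f₂ :=
      (integrable_indicator_iff measurableSet_ball.compl).2 (hout' y R hR).1
    have i₃ : Integrable f₃ :=
      (integrable_indicator_iff measurableSet_ball.compl).2 (hout' c R hR).1
    have p₁ : ∀ z, 0 ≤ f₁ z := indicator_nonneg fun z _ => by positivity
    have p₂ : ∀ z, 0 ≤ f₂ z := indicator_nonneg fun z _ => by positivity
    have p₃ : ∀ z, 0 ≤ f₃ z := indicator_nonneg fun z _ => by positivity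
    have hle : ∀ z ∈ (ball c R)ᶜ, (‖y - z‖ ^ k)⁻¹ * (‖z - c‖ ^ 12)⁻¹ ≤ f₁ z + f₂ z + f₃ z := by
      intro z hz
      have hzR : R ≤ ‖z - c‖ := by simpa [dist_eq_norm] using hz
      by_cases hy : z ∈ ball y R
      · have : (‖y - z‖ ^ k)⁻¹ * (‖z - c‖ ^ 12)⁻¹ ≤ f₁ z := by
          simp only [f₁, indicator_of_mem hy]
          rw [mul_comm]
          gcongr
        linarith [p₂ z, p₃ z]
      · have hyR : R ≤ ‖z - y‖ := by simpa [dist_eq_norm] using hy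
        have : (‖y - z‖ ^ k)⁻¹ * (‖z - c‖ ^ 12)⁻¹ ≤ f₂ z + f₃ z := by
          simp only [f₂, f₃, indicator_of_mem hz, indicator_of_mem (mem_compl hy)]
          rw [norm_sub_rev y]
          exact inv_pow_mul_inv_pow_le (hR.trans_le hyR) (hR.trans_le hzR) k
        linarith [p₁ z]
    have i₁₂ : Integrable (fun z => f₁ z + f₂ z) := i₁.add i₂
    have isum : IntegrableOn (fun z => f₁ z + f₂ z + f₃ z) (ball c R)ᶜ :=
      (i₁₂.add i₃).integrableOn
    have iprod : IntegrableOn (fun z : E => (‖y - z‖ ^ k)⁻¹ * (‖z - c‖ ^ 12)⁻¹) (ball c R)ᶜ := by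
      refine isum.mono' (Measurable.aestronglyMeasurable (by fun_prop)) ?_
      filter_upwards [ae_restrict_mem measurableSet_ball.compl] with z hz
      rw [norm_of_nonneg (by positivity)]
      exact hle z hz
    refine ⟨iprod, ?_⟩
    calc _ ≤ ∫ z in (ball c R)ᶜ, (f₁ z + f₂ z + f₃ z) :=
          setIntegral_mono_on iprod isum measurableSet_ball.compl hle
      _ ≤ ∫ z, (f₁ z + f₂ z + f₃ z) :=
          setIntegral_le_integral (i₁₂.add i₃)
            (Eventually.of_forall fun z => by have := p₁ z; have := p₂ z; have := p₃ z; positivity)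
      _ = 3 * A * (R ^ 6)⁻¹ := by
          rw [integral_add i₁₂ i₃, integral_add i₁ i₂,
            integral_indicator measurableSet_ball, integral_indicator measurableSet_ball.compl,
            integral_indicator measurableSet_ball.compl, integral_const_mul, (hin' y R hR).2,
            (hout' y R hR).2, (hout' c R hR).2]
          field_simp
          ring

end RieszKernel

section Inversion
open EuclideanGeometry

variable {E : Type*} [NormedAddCommGroup E] [InnerProductSpace ℝ E] {k : ℕ}

lemma image_inversion_compl_closedBall (c : E) {r : ℝ} (hr : 0 < r) :
    inversion c r '' (closedBall c r)ᶜ = ball c r \ {c} := by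
  have key : ∀ z, z ≠ c → (dist (inversion c r z) c < r ↔ r < dist z c) := fun z hz => by
    have hd := dist_pos.2 hz
    rw [dist_inversion_center, div_lt_iff₀ hd, sq, mul_lt_mul_iff_right₀ hr]
  ext z
  simp only [mem_image, mem_compl_iff, mem_closedBall, not_le, Set.mem_sdiff, mem_ball,
    mem_singleton_iff]
  constructor
  · rintro ⟨w, hw, rfl⟩
    have hwc : w ≠ c := dist_pos.1 (hr.trans hw)
    exact ⟨(key w hwc).2 hw, by simpa [inversion_eq_center hr.ne'] using hwc⟩
  · rintro ⟨h, hzc⟩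
    refine ⟨inversion c r z, ?_, inversion_inversion c hr.ne' z⟩
    have := key (inversion c r z) (by simpa [inversion_eq_center hr.ne'] using hzc)
    rw [inversion_inversion c hr.ne'] at this
    exact this.1 h

/-- The Kelvin transform of order `k` with respect to the sphere of centre `c` and radius `r`. -/
def kelvin (k : ℕ) (c : E) (r : ℝ) (u : E → ℝ) (z : E) : ℝ :=
  (r / dist z c) ^ k * u (inversion c r z)

/-- The Riesz kernel with pole at the inversion of `x`, rescaled so as to agree with
`‖x - z‖⁻ᵏ` for `z` on the sphere of centre `c` and radius `r`. -/
def imageKernel (k : ℕ) (c : E) (r : ℝ) (x z : E) : ℝ :=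
  (r / dist x c) ^ k * (‖inversion c r x - z‖ ^ k)⁻¹

variable {p C : ℝ} {u : E → ℝ} {c : E} {r : ℝ}

lemma kelvin_rpow (hp : p * k = k + 12) (hu : ∀ x, 0 < u x) (hr : 0 < r) {z : E} (hz : z ≠ c) :
    kelvin k c r u z ^ p = (r / dist z c) ^ (k + 12) * u (inversion c r z) ^ p := by
  have hd := dist_pos.2 hz
  rw [kelvin, mul_rpow (by positivity) (hu _).le, ← rpow_natCast, ← rpow_mul (by positivity),
    mul_comm (k : ℝ), hp, ← rpow_natCast]
  push_cast
  rfl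

lemma kernel_inversion_right {x z : E} (hx : x ≠ c) (hz : z ≠ c) :
    (r / dist z c) ^ k * (‖x - inversion c r z‖ ^ k)⁻¹ = imageKernel k c r x z := by
  have hxd := dist_pos.2 hx
  have hzd := dist_pos.2 hz
  have h := dist_inversion_mul_dist_center_eq (R := r) hx hz
  rw [imageKernel, ← dist_eq_norm, ← dist_eq_norm, ← inv_pow, ← mul_pow, ← inv_pow, ← mul_pow]
  congr 1
  rw [div_mul_eq_mul_div, div_mul_eq_mul_div, mul_div_assoc, mul_div_assoc, inv_eq_one_div,
    inv_eq_one_div, div_div, div_div, h]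

lemma kernel_inversion_both (hr : 0 < r) {x z : E} (hx : x ≠ c) (hz : z ≠ c) :
    (r / dist z c) ^ k * imageKernel k c r x (inversion c r z) = (‖x - z‖ ^ k)⁻¹ := by
  have hxd := dist_pos.2 hx
  have hzd := dist_pos.2 hz
  rw [imageKernel, ← dist_eq_norm, ← dist_eq_norm, dist_inversion_inversion hx hz,
    ← inv_pow, ← mul_pow, ← mul_pow, ← inv_pow]
  congr 1
  rw [mul_inv]
  field_simp

lemma imageKernel_nonneg (hr : 0 < r) (x z : E) : 0 ≤ imageKernel k c r x z := by
  unfold imageKernel; positivity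

lemma imageKernel_lt (hk : k ≠ 0) (hr : 0 < r) {x z : E} (hx : r < dist x c) (hz : r < dist z c)
    (hxz : x ≠ z) : imageKernel k c r x z < (‖x - z‖ ^ k)⁻¹ := by
  have hxd := hr.trans hx
  have hxz' : 0 < ‖x - z‖ := norm_pos_iff.2 (sub_ne_zero.2 hxz)
  have key : r * ‖x - z‖ < dist x c * ‖inversion c r x - z‖ := by
    refine lt_of_pow_lt_pow_left₀ 2 (by positivity) ?_
    rw [mul_pow, mul_pow]
    have e : inversion c r x - z = (r / dist x c) ^ 2 • (x - c) - (z - c) := by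
      simp only [inversion, vsub_eq_sub, vadd_eq_add]; abel
    have e' : x - z = (x - c) - (z - c) := by abel
    rw [e, e', norm_sub_sq_real (x - c), norm_sub_sq_real (_ • _), norm_smul, real_inner_smul_left,
      ← dist_eq_norm, ← dist_eq_norm, norm_of_nonneg (by positivity)]
    have : 0 < (dist x c ^ 2 - r ^ 2) * (dist z c ^ 2 - r ^ 2) := by
      apply mul_pos <;> nlinarith
    have expand : dist x c ^ 2 * (((r / dist x c) ^ 2 * dist x c) ^ 2 -
        2 * ((r / dist x c) ^ 2 * inner ℝ (x - c) (z - c)) + dist z c ^ 2) =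
        r ^ 4 - 2 * r ^ 2 * inner ℝ (x - c) (z - c) + dist x c ^ 2 * dist z c ^ 2 := by
      field_simp
    rw [expand]
    nlinarith
  have hpos : 0 < ‖inversion c r x - z‖ := by
    by_contra h
    have h0 : ‖inversion c r x - z‖ = 0 := le_antisymm (not_lt.1 h) (norm_nonneg _)
    rw [h0] at key
    nlinarith
  rw [imageKernel, ← inv_pow, ← mul_pow, ← inv_pow]
  refine pow_lt_pow_left₀ ?_ (by positivity) hk
  rw [← div_eq_mul_inv, div_div, div_lt_iff₀ (by positivity), inv_mul_eq_div, lt_div_iff₀ hxz']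
  exact key

lemma inversion_ne_zero (hr : 0 < r) (hrc : r < ‖c‖) {x : E} (hx : r < dist x c) :
    inversion c r x ≠ 0 := by
  intro h
  have h1 := dist_inversion_center c x r
  rw [h, dist_zero_left, eq_div_iff (hr.trans hx).ne'] at h1
  nlinarith

variable [FiniteDimensional ℝ E]

lemma abs_det_smul_reflection (a : ℝ) (K : Submodule ℝ E) :
    |((a ^ 2 • (K.reflection : E →L[ℝ] E) : E →L[ℝ] E)).det| = (a ^ 2) ^ finrank ℝ E := by
  have h : |LinearMap.det (K.reflection : E →L[ℝ] E).toLinearMap| = 1 := by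
    have := K.det_reflection
    erw [this]
    simp
  simp only [ContinuousLinearMap.det, ContinuousLinearMap.toLinearMap_smul, LinearMap.det_smul,
    abs_mul, h, mul_one]
  exact abs_of_nonneg (by positivity)

variable [MeasurableSpace E] [BorelSpace E]

lemma ball_ae_eq_closedBall [Nontrivial E] (c : E) (r : ℝ) :
    (ball c r : Set E) =ᵐ[volume] closedBall c r := by
  rw [← closedBall_sdiff_sphere]
  exact sdiff_null_ae_eq_self (Measure.addHaar_sphere volume c r)

lemma inversion_change_of_variables (hE : finrank ℝ E = k + 6) (c : E) {r : ℝ} (hr : 0 < r)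
    (f : E → ℝ) :
    (IntegrableOn f (ball c r) ↔ IntegrableOn
      (fun z => (r / dist z c) ^ (2 * (k + 6)) * f (inversion c r z)) (closedBall c r)ᶜ) ∧
    ∫ z in ball c r, f z =
      ∫ z in (closedBall c r)ᶜ, (r / dist z c) ^ (2 * (k + 6)) * f (inversion c r z) := by
  have : Nontrivial E := Module.nontrivial_of_finrank_pos (R := ℝ) (by omega)
  have hset : inversion c r '' (closedBall c r)ᶜ =ᵐ[volume] ball c r := by
    rw [image_inversion_compl_closedBall c hr]
    exact sdiff_null_ae_eq_self (by simp)
  have hd : ∀ x ∈ (closedBall c r)ᶜ, HasFDerivWithinAt (inversion c r)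
      ((r / dist x c) ^ 2 • ((ℝ ∙ (x - c))ᗮ.reflection : E →L[ℝ] E)) (closedBall c r)ᶜ x := by
    intro x hx
    have hxc : x ≠ c := by rintro rfl; simp [hr.le] at hx
    exact (hasFDerivAt_inversion hxc).hasFDerivWithinAt
  have hm : MeasurableSet (closedBall c r)ᶜ := measurableSet_closedBall.compl
  have h1 := integrableOn_image_iff_integrableOn_abs_det_fderiv_smul volume hm hd
    (inversion_injective c hr.ne').injOn f
  have h2 := integral_image_eq_integral_abs_det_fderiv_smul volume hm hd
    (inversion_injective c hr.ne').injOn f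
  simp only [abs_det_smul_reflection, hE, ← pow_mul, smul_eq_mul] at h1 h2
  exact ⟨(integrableOn_congr_set_ae hset).symm.trans h1, (setIntegral_congr_set hset).symm.trans h2⟩

/-- Positive solutions of the integral equation `u = C |·|⁻ᵏ * uᵖ` away from the origin. -/
structure IsRieszSolution (k : ℕ) (p C : ℝ) (u : E → ℝ) : Prop where
  pos : ∀ x, 0 < u x
  cont : ContinuousOn u {0}ᶜ
  integrable : ∀ x, x ≠ 0 → Integrable fun z => (‖x - z‖ ^ k)⁻¹ * u z ^ p
  eq : ∀ x, x ≠ 0 → u x = C * ∫ z, (‖x - z‖ ^ k)⁻¹ * u z ^ p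

lemma IsRieszSolution.sub_kelvin (hE : finrank ℝ E = k + 6) (hp : p * k = k + 12)
    (hu : IsRieszSolution k p C u) (hr : 0 < r) (hrc : r < ‖c‖) {x : E} (hx : r < dist x c)
    (hx0 : x ≠ 0) :
    IntegrableOn (fun z => ((‖x - z‖ ^ k)⁻¹ - imageKernel k c r x z) *
      (u z ^ p - kelvin k c r u z ^ p)) (closedBall c r)ᶜ ∧
    u x - kelvin k c r u x = C * ∫ z in (closedBall c r)ᶜ,
      ((‖x - z‖ ^ k)⁻¹ - imageKernel k c r x z) * (u z ^ p - kelvin k c r u z ^ p) := by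
  have : Nontrivial E := Module.nontrivial_of_finrank_pos (R := ℝ) (by omega)
  have hxc : x ≠ c := dist_pos.1 (hr.trans hx)
  have hm : MeasurableSet (closedBall c r)ᶜ := measurableSet_closedBall.compl
  set y := inversion c r x with hy
  have hy0 : y ≠ 0 := inversion_ne_zero hr hrc hx
  have split : ∀ f : E → ℝ, Integrable f →
      ∫ z, f z = (∫ z in (closedBall c r)ᶜ, f z) + ∫ z in ball c r, f z := fun f hf => by
    rw [← integral_add_compl measurableSet_closedBall hf, add_comm]
    congr 1
    exact setIntegral_congr_set (ball_ae_eq_closedBall c r).symm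
  have ne_c : ∀ z ∈ (closedBall c r)ᶜ, z ≠ c := by
    rintro z hz rfl; simp [hr.le] at hz
  have ix := hu.integrable x hx0
  have iy := (hu.integrable y hy0).const_mul ((r / dist x c) ^ k)
  have eqx : EqOn (fun z => (r / dist z c) ^ (2 * (k + 6)) *
      ((‖x - inversion c r z‖ ^ k)⁻¹ * u (inversion c r z) ^ p))
      (fun z => imageKernel k c r x z * kelvin k c r u z ^ p) (closedBall c r)ᶜ := by
    intro z hz
    simp only
    rw [kelvin_rpow hp hu.pos hr (ne_c z hz), ← kernel_inversion_right hxc (ne_c z hz),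
      show 2 * (k + 6) = k + (k + 12) by ring, pow_add _ k (k + 12)]
    ring
  have eqy : EqOn (fun z => (r / dist z c) ^ (2 * (k + 6)) *
      ((r / dist x c) ^ k * ((‖y - inversion c r z‖ ^ k)⁻¹ * u (inversion c r z) ^ p)))
      (fun z => (‖x - z‖ ^ k)⁻¹ * kelvin k c r u z ^ p) (closedBall c r)ᶜ := by
    intro z hz
    simp only
    rw [kelvin_rpow hp hu.pos hr (ne_c z hz), ← kernel_inversion_both hr hxc (ne_c z hz),
      show 2 * (k + 6) = k + (k + 12) by ring, pow_add _ k (k + 12), imageKernel]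
    ring
  have cx := inversion_change_of_variables hE c hr fun z => (‖x - z‖ ^ k)⁻¹ * u z ^ p
  have cy := inversion_change_of_variables hE c hr fun z =>
    (r / dist x c) ^ k * ((‖y - z‖ ^ k)⁻¹ * u z ^ p)
  rw [integrableOn_congr_fun eqx hm, setIntegral_congr_fun hm eqx] at cx
  rw [integrableOn_congr_fun eqy hm, setIntegral_congr_fun hm eqy] at cy
  have i1 := ix.integrableOn (s := (closedBall c r)ᶜ)
  have i2 := cx.1.1 ix.integrableOn
  have i3 : IntegrableOn (fun z => imageKernel k c r x z * u z ^ p) (closedBall c r)ᶜ :=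
    (iy.integrableOn (s := (closedBall c r)ᶜ)).congr_fun
      (fun z _ => by simp only [imageKernel]; ring) hm
  have i4 := cy.1.1 iy.integrableOn
  have hsplit : ∀ z, ((‖x - z‖ ^ k)⁻¹ - imageKernel k c r x z) *
      (u z ^ p - kelvin k c r u z ^ p) =
      ((‖x - z‖ ^ k)⁻¹ * u z ^ p + imageKernel k c r x z * kelvin k c r u z ^ p) -
      (imageKernel k c r x z * u z ^ p + (‖x - z‖ ^ k)⁻¹ * kelvin k c r u z ^ p) :=
    fun z => by ring
  have i12 : IntegrableOn (fun z => (‖x - z‖ ^ k)⁻¹ * u z ^ p +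
    imageKernel k c r x z * kelvin k c r u z ^ p) (closedBall c r)ᶜ := i1.add i2
  have i34 : IntegrableOn (fun z => imageKernel k c r x z * u z ^ p +
    (‖x - z‖ ^ k)⁻¹ * kelvin k c r u z ^ p) (closedBall c r)ᶜ := i3.add i4
  simp_rw [hsplit]
  refine ⟨i12.sub i34, ?_⟩
  rw [integral_sub i12 i34, integral_add i1 i2, integral_add i3 i4, hu.eq x hx0, kelvin, ← hy,
    hu.eq y hy0, split _ ix, cx.2, mul_left_comm, ← integral_const_mul, split _ iy, cy.2, ← mul_sub]
  congr 3
  exact setIntegral_congr_fun hm fun z _ => by simp only [imageKernel, ← hy]; ring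

end Inversion

section MovingSpheres
open EuclideanGeometry

lemma rpow_sub_rpow_le {a b p : ℝ} (ha : 0 < a) (hb : 0 < b) (hp : 1 ≤ p) :
    b ^ p - a ^ p ≤ p * b ^ (p - 1) * (b - a) := by
  have h := one_add_mul_self_le_rpow_one_add (s := a / b - 1)
    (by have := div_pos ha hb; linarith) hp
  rw [add_sub_cancel, div_rpow ha.le hb.le, le_div_iff₀ (by positivity)] at h
  rw [rpow_sub_one hb.ne']
  have : p * (b ^ p / b) * (b - a) = b ^ p - (1 + p * (a / b - 1)) * b ^ p := by
    field_simp; ring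
  linarith

variable {E : Type*} [NormedAddCommGroup E] [InnerProductSpace ℝ E] {k : ℕ}
  {p C : ℝ} {u : E → ℝ} {c : E} {r : ℝ}

/-- The points outside the closed ball, other than the origin, where `u` lies below its
Kelvin transform. -/
def violationSet (k : ℕ) (c : E) (r : ℝ) (u : E → ℝ) : Set E :=
  {z | r < dist z c ∧ z ≠ 0 ∧ u z < kelvin k c r u z}

lemma violationSet_subset : violationSet k c r u ⊆ (closedBall c r)ᶜ := fun z hz => by
  simpa using hz.1

lemma dist_inversion_lt (hr : 0 < r) {z : E} (hz : r < dist z c) :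
    dist (inversion c r z) c < r := by
  rw [dist_inversion_center, div_lt_iff₀ (hr.trans hz), sq]
  gcongr

lemma kelvin_le {M : ℝ} (hM : ∀ z ∈ closedBall c r, u z ≤ M) (hr : 0 < r) {z : E}
    (hz : r < dist z c) : kelvin k c r u z ≤ (r / dist z c) ^ k * M := by
  have := hr.trans hz
  unfold kelvin
  gcongr
  exact hM _ (dist_inversion_lt hr hz).le

lemma kelvin_le_of_nonneg {M : ℝ} (hM : ∀ z ∈ closedBall c r, u z ≤ M) (hM0 : 0 ≤ M) (hr : 0 < r)
    {z : E} (hz : r < dist z c) : kelvin k c r u z ≤ M := by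
  have := hr.trans hz
  refine (kelvin_le hM hr hz).trans (mul_le_of_le_one_left hM0 (pow_le_one₀ (by positivity) ?_))
  exact (div_le_one this).2 hz.le

lemma kelvin_pos (hu : ∀ x, 0 < u x) (hr : 0 < r) {z : E} (hz : r < dist z c) :
    0 < kelvin k c r u z := by
  have := hr.trans hz
  have := hu (inversion c r z)
  unfold kelvin
  positivity

lemma kelvin_rpow_sub_one_le {M : ℝ} (hM : ∀ z ∈ closedBall c r, u z ≤ M) (hM0 : 0 ≤ M)
    (hu : ∀ x, 0 < u x) (hp : p * k = k + 12) (hp1 : 1 ≤ p) (hr : 0 < r) {z : E}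
    (hz : r < dist z c) :
    kelvin k c r u z ^ (p - 1) ≤ M ^ (p - 1) * (r ^ 12 * (‖z - c‖ ^ 12)⁻¹) := by
  have hd := hr.trans hz
  calc kelvin k c r u z ^ (p - 1) ≤ ((r / dist z c) ^ k * M) ^ (p - 1) := by
        have := kelvin_pos (k := k) hu hr hz
        have : 0 ≤ p - 1 := by linarith
        gcongr
        exact kelvin_le hM hr hz
    _ = M ^ (p - 1) * (r ^ 12 * (‖z - c‖ ^ 12)⁻¹) := by
        rw [mul_rpow (by positivity) hM0, ← rpow_natCast, ← rpow_mul (by positivity),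
          show (k : ℝ) * (p - 1) = ((12 : ℕ) : ℝ) by push_cast; linarith, rpow_natCast, mul_comm,
          div_pow, div_eq_mul_inv, dist_eq_norm]

lemma continuousAt_kelvin_radius (hu : ContinuousOn u {0}ᶜ) (hr : 0 < r) (hrc : r < ‖c‖) {z : E}
    (hz : r < dist z c) : ContinuousAt (fun r => kelvin k c r u z) r := by
  have hd := hr.trans hz
  have h1 : ContinuousAt (fun r => inversion c r z) r :=
    ContinuousAt.inversion continuousAt_const continuousAt_id continuousAt_const
      (dist_pos.1 hd)
  have h2 : ContinuousAt u (inversion c r z) :=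
    hu.continuousAt (isOpen_compl_singleton.mem_nhds (inversion_ne_zero hr hrc hz))
  exact ((continuousAt_id.div_const _).pow k).mul (ContinuousAt.comp (f := fun r => inversion c r z)
    (g := u) h2 h1)

variable [FiniteDimensional ℝ E] [MeasurableSpace E] [BorelSpace E]

lemma IsRieszSolution.measurable (hu : IsRieszSolution k p C u) : Measurable u :=
  measurable_of_continuousOn_compl_singleton 0 hu.cont

lemma IsRieszSolution.measurable_kelvin (hu : IsRieszSolution k p C u) (c : E) (r : ℝ) :
    Measurable (kelvin k c r u) := by
  have h : Measurable (inversion c r) := by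
    unfold inversion
    simp only [vsub_eq_sub, vadd_eq_add]
    fun_prop
  have hd : Measurable fun z : E => (r / dist z c) ^ k := by fun_prop
  exact hd.mul (hu.measurable.comp h)

lemma IsRieszSolution.measurableSet_violationSet (hu : IsRieszSolution k p C u) (c : E) (r : ℝ) :
    MeasurableSet (violationSet k c r u) := by
  refine (measurableSet_lt measurable_const (measurable_id.dist measurable_const)).inter
    ((measurableSet_singleton (0 : E)).compl.inter
      (measurableSet_lt hu.measurable (hu.measurable_kelvin c r)))

lemma IsRieszSolution.exists_bound (hu : IsRieszSolution k p C u) (hrc : r < ‖c‖) :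
    ∃ M : ℝ, 0 ≤ M ∧ ∀ z ∈ closedBall c r, u z ≤ M := by
  have hsub : closedBall c r ⊆ {0}ᶜ := by
    rintro z hz rfl
    simp [dist_zero_left] at hz
    linarith
  obtain ⟨M, hM⟩ := (isCompact_closedBall c r).bddAbove_image (hu.cont.mono hsub)
  exact ⟨max M 0, le_max_right _ _, fun z hz => (hM (mem_image_of_mem _ hz)).trans (le_max_left _ _)⟩

/-- Maximum principle on a small set of violation. -/
lemma IsRieszSolution.violationSet_eq_empty_of_small (hE : finrank ℝ E = k + 6)
    (hp : p * k = k + 12) (hp1 : 1 ≤ p) (hC : 0 < C) (hu : IsRieszSolution k p C u)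
    (hr : 0 < r) (hrc : r < ‖c‖) {M : ℝ} (hM0 : 0 ≤ M) (hM : ∀ z ∈ closedBall c r, u z ≤ M)
    (hint : ∀ x : E, IntegrableOn (fun z => (‖x - z‖ ^ k)⁻¹ * (‖z - c‖ ^ 12)⁻¹)
      (violationSet k c r u))
    (hsmall : ∀ x : E, C * p * M ^ (p - 1) * (r ^ 12 *
      ∫ z in violationSet k c r u, (‖x - z‖ ^ k)⁻¹ * (‖z - c‖ ^ 12)⁻¹) ≤ 1 / 2) :
    violationSet k c r u = ∅ := by
  have : Nontrivial E := Module.nontrivial_of_finrank_pos (R := ℝ) (by omega)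
  have hk : p * k ≠ 0 := by rw [hp]; positivity
  have hk : k ≠ 0 := by rintro rfl; simp at hk
  by_contra hne
  obtain ⟨x₀, hx₀⟩ := nonempty_iff_ne_empty.2 hne
  set V := violationSet k c r u with hV
  set w : E → ℝ := fun z => kelvin k c r u z - u z with hw
  have hbdd : BddAbove (w '' V) := by
    refine ⟨M, ?_⟩
    rintro _ ⟨z, hz, rfl⟩
    have := kelvin_le_of_nonneg (k := k) hM hM0 hr hz.1
    have := hu.pos z
    simp only [hw]
    linarith
  set S := sSup (w '' V)
  have hwS : ∀ z ∈ V, w z ≤ S := fun z hz => le_csSup hbdd (mem_image_of_mem w hz)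
  have hSpos : 0 < S := (sub_pos.2 hx₀.2.2).trans_le (hwS x₀ hx₀)
  have hhalf : ∀ x ∈ V, w x ≤ S / 2 := by
    intro x hx
    obtain ⟨hi, heq⟩ := hu.sub_kelvin hE hp hr hrc hx.1 hx.2.1
    set g : E → ℝ := fun z => p * M ^ (p - 1) * r ^ 12 * S * ((‖x - z‖ ^ k)⁻¹ * (‖z - c‖ ^ 12)⁻¹)
    have hmV : MeasurableSet V := hu.measurableSet_violationSet c r
    have hgi : IntegrableOn g V := (hint x).const_mul _
    have hgi' : Integrable (V.indicator g) := (integrable_indicator_iff hmV).2 hgi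
    have hle : ∫ z in (closedBall c r)ᶜ, -(V.indicator g z) ≤ ∫ z in (closedBall c r)ᶜ,
        ((‖x - z‖ ^ k)⁻¹ - imageKernel k c r x z) * (u z ^ p - kelvin k c r u z ^ p) := by
      refine integral_mono_ae hgi'.neg.integrableOn hi ?_
      filter_upwards [ae_restrict_mem measurableSet_closedBall.compl,
        ae_restrict_of_ae (Measure.ae_ne volume x), ae_restrict_of_ae (Measure.ae_ne volume 0)]
        with z hz hzx hz0
      have hzr : r < dist z c := by simpa using hz
      have hB := imageKernel_nonneg (k := k) (c := c) hr x z
      have hAB := (imageKernel_lt hk hr hx.1 hzr hzx.symm).le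
      have hkp := kelvin_pos (k := k) hu.pos hr hzr
      by_cases hzV : z ∈ V
      · rw [indicator_of_mem hzV]
        have h1 : kelvin k c r u z ^ p - u z ^ p ≤
            p * (M ^ (p - 1) * (r ^ 12 * (‖z - c‖ ^ 12)⁻¹)) * S := by
          refine (rpow_sub_rpow_le (hu.pos z) hkp hp1).trans ?_
          have h2 := kelvin_rpow_sub_one_le hM hM0 hu.pos hp hp1 hr hzr
          have h3 := hwS z hzV
          have h4 : 0 ≤ kelvin k c r u z - u z := sub_nonneg.2 hzV.2.2.le
          have h5 : 0 ≤ kelvin k c r u z ^ (p - 1) := by positivity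
          gcongr
        have h0 : 0 ≤ kelvin k c r u z ^ p - u z ^ p :=
          sub_nonneg.2 (rpow_le_rpow (hu.pos z).le hzV.2.2.le (by linarith))
        have h6 : ((‖x - z‖ ^ k)⁻¹ - imageKernel k c r x z) *
            (kelvin k c r u z ^ p - u z ^ p) ≤ g z := by
          calc _ ≤ (‖x - z‖ ^ k)⁻¹ * (p * (M ^ (p - 1) * (r ^ 12 * (‖z - c‖ ^ 12)⁻¹)) * S) := by
                gcongr
                linarith
            _ = g z := by simp only [g]; ring
        linarith
      · rw [indicator_of_notMem hzV, neg_zero]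
        have : kelvin k c r u z ≤ u z := by
          by_contra h
          exact hzV ⟨hzr, hz0, not_le.1 h⟩
        exact mul_nonneg (sub_nonneg.2 hAB)
          (sub_nonneg.2 (rpow_le_rpow hkp.le this (by linarith)))
    rw [integral_neg, setIntegral_indicator hmV, inter_eq_right.2 violationSet_subset,
      integral_const_mul] at hle
    have h1 := mul_le_mul_of_nonneg_left hle hC.le
    rw [← heq] at h1
    have h2 := mul_le_mul_of_nonneg_right (hsmall x) hSpos.le
    simp only [hw]
    nlinarith
  have : S ≤ S / 2 := csSup_le ⟨_, mem_image_of_mem w hx₀⟩ (by rintro _ ⟨z, hz, rfl⟩; exact hhalf z hz)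
  linarith

lemma IsRieszSolution.eventually_violationSet_eq_empty_zero (hE : finrank ℝ E = k + 6)
    (hp : p * k = k + 12) (hp1 : 1 ≤ p) (hC : 0 < C) (hu : IsRieszSolution k p C u)
    (hc : c ≠ 0) : ∀ᶠ r in 𝓝[>] (0 : ℝ), violationSet k c r u = ∅ := by
  obtain ⟨A, hA, -, htail⟩ := exists_riesz_potential_bound (E := E) hE
  have hc' : 0 < ‖c‖ := norm_pos_iff.2 hc
  obtain ⟨M, hM0, hM⟩ := hu.exists_bound (c := c) (r := ‖c‖ / 2) (by linarith)
  have hlim : Tendsto (fun r : ℝ => C * p * M ^ (p - 1) * A * r ^ 6) (𝓝[>] 0) (𝓝 0) := by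
    have : Continuous fun r : ℝ => C * p * M ^ (p - 1) * A * r ^ 6 := by fun_prop
    simpa using (this.tendsto 0).mono_left nhdsWithin_le_nhds
  have hlt : ∀ᶠ r in 𝓝[>] (0 : ℝ), r < ‖c‖ / 2 :=
    nhdsWithin_le_nhds (Iio_mem_nhds (by positivity))
  filter_upwards [hlim.eventually_lt_const (show (0 : ℝ) < 1 / 2 by norm_num), hlt,
    self_mem_nhdsWithin] with r h1 h2 h0
  have h0 : 0 < r := h0
  have hsub : violationSet k c r u ⊆ (ball c r)ᶜ :=
    violationSet_subset.trans (compl_subset_compl.2 ball_subset_closedBall)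
  refine hu.violationSet_eq_empty_of_small hE hp hp1 hC h0 (by linarith) hM0
    (fun z hz => hM z (closedBall_subset_closedBall h2.le hz))
    (fun x => (htail x c r h0).1.mono_set hsub) fun x => ?_
  have h3 : ∫ z in violationSet k c r u, (‖x - z‖ ^ k)⁻¹ * (‖z - c‖ ^ 12)⁻¹ ≤ A * (r ^ 6)⁻¹ :=
    (setIntegral_mono_set (htail x c r h0).1 (Eventually.of_forall fun z => by positivity)
      (LE.le.eventuallyLE hsub)).trans (htail x c r h0).2
  have h4 : r ^ 12 * (A * (r ^ 6)⁻¹) = A * r ^ 6 := by field_simp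
  calc _ ≤ C * p * M ^ (p - 1) * (r ^ 12 * (A * (r ^ 6)⁻¹)) := by gcongr
    _ ≤ 1 / 2 := by rw [h4, ← mul_assoc]; exact h1.le

lemma IsRieszSolution.kelvin_lt (hE : finrank ℝ E = k + 6)
    (hp : p * k = k + 12) (hp1 : 1 ≤ p) (hC : 0 < C) (hu : IsRieszSolution k p C u)
    (hsing : ∀ M ε : ℝ, 0 < ε → ∃ x : E, x ≠ 0 ∧ ‖x‖ < ε ∧ M < u x)
    (hr : 0 < r) (hrc : r < ‖c‖) (hV : violationSet k c r u = ∅) {x : E} (hx : r < dist x c)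
    (hx0 : x ≠ 0) : kelvin k c r u x < u x := by
  have : Nontrivial E := Module.nontrivial_of_finrank_pos (R := ℝ) (by omega)
  have hk : p * k ≠ 0 := by rw [hp]; positivity
  have hk : k ≠ 0 := by rintro rfl; simp at hk
  obtain ⟨M, hM0, hM⟩ := hu.exists_bound hrc
  obtain ⟨x₀, hx₀, hx₀c, hMx₀⟩ := hsing M (‖c‖ - r) (by linarith)
  set N : Set E := ({0}ᶜ ∩ u ⁻¹' Ioi M) ∩ (closedBall c r)ᶜ with hN
  have hNo : IsOpen N := (hu.cont.isOpen_inter_preimage isOpen_compl_singleton isOpen_Ioi).inter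
    isClosed_closedBall.isOpen_compl
  have hNx : x₀ ∈ N := by
    refine ⟨⟨hx₀, hMx₀⟩, ?_⟩
    have := norm_sub_norm_le c x₀
    simp only [mem_compl_iff, mem_closedBall, dist_eq_norm, norm_sub_rev x₀]
    linarith
  have hNpos : 0 < volume N := hNo.measure_pos volume ⟨x₀, hNx⟩
  obtain ⟨hi, heq⟩ := hu.sub_kelvin hE hp hr hrc hx hx0
  rw [← sub_pos, heq]
  refine mul_pos hC ?_
  have hle : ∀ z, r < dist z c → z ≠ 0 → kelvin k c r u z ≤ u z := fun z hz hz0 => by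
    by_contra h
    have : z ∈ violationSet k c r u := ⟨hz, hz0, not_le.1 h⟩
    simp [hV] at this
  rw [setIntegral_pos_iff_support_of_nonneg_ae _ hi]
  · refine lt_of_lt_of_le ?_ (measure_mono (s := N \ {x}) ?_)
    · rwa [measure_sdiff_null (by simp)]
    · rintro z ⟨⟨⟨hz0, hzM⟩, hzc⟩, hzx⟩
      have hzr : r < dist z c := by simpa using hzc
      refine ⟨(mul_pos (sub_pos.2 (imageKernel_lt hk hr hx hzr (Ne.symm hzx)))
        (sub_pos.2 (rpow_lt_rpow (kelvin_pos hu.pos hr hzr).le ?_ (by linarith)))).ne', hzc⟩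
      exact (kelvin_le_of_nonneg hM hM0 hr hzr).trans_lt hzM
  · filter_upwards [ae_restrict_mem measurableSet_closedBall.compl,
        ae_restrict_of_ae (Measure.ae_ne volume x), ae_restrict_of_ae (Measure.ae_ne volume 0)]
        with z hz hzx hz0
    have hzr : r < dist z c := by simpa using hz
    exact mul_nonneg (sub_nonneg.2 (imageKernel_lt hk hr hx hzr hzx.symm).le)
      (sub_nonneg.2 (rpow_le_rpow (kelvin_pos hu.pos hr hzr).le (hle z hzr hz0) (by linarith)))

lemma IsRieszSolution.eventually_violationSet_eq_empty (hE : finrank ℝ E = k + 6)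
    (hp : p * k = k + 12) (hp1 : 1 ≤ p) (hC : 0 < C) (hu : IsRieszSolution k p C u)
    (hsing : ∀ M ε : ℝ, 0 < ε → ∃ x : E, x ≠ 0 ∧ ‖x‖ < ε ∧ M < u x)
    (hr : 0 < r) (hrc : r < ‖c‖) (hV : violationSet k c r u = ∅) :
    ∀ᶠ s in 𝓝 r, violationSet k c s u = ∅ := by
  have : Nontrivial E := Module.nontrivial_of_finrank_pos (R := ℝ) (by omega)
  obtain ⟨A, hA, hnear, htail⟩ := exists_riesz_potential_bound (E := E) hE
  obtain ⟨L, hrL, hLc⟩ := exists_between hrc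
  obtain ⟨M, hM0, hM⟩ := hu.exists_bound hLc
  have hc : 0 < ‖c‖ := hr.trans hrc
  set κ := C * p * M ^ (p - 1) with hκ
  have hκ0 : 0 ≤ κ := by positivity
  obtain ⟨R, hR, hRsmall⟩ : ∃ R : ℝ, 0 < R ∧ κ * (‖c‖ ^ 12 * (A * (R ^ 6)⁻¹)) < 1 / 8 := by
    have h1 : Tendsto (fun R : ℝ => κ * (‖c‖ ^ 12 * (A * (R ^ 6)⁻¹))) atTop (𝓝 0) := by
      simpa using ((((tendsto_pow_atTop (α := ℝ) (n := 6) (by norm_num)).inv_tendsto_atTop).const_mul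
        A).const_mul (‖c‖ ^ 12)).const_mul κ
    obtain ⟨R, h2, h3⟩ := ((eventually_gt_atTop 0).and
      (h1.eventually_lt_const (show (0 : ℝ) < 1 / 8 by norm_num))).exists
    exact ⟨R, h2, h3⟩
  obtain ⟨δ, hδ, hδsmall⟩ : ∃ δ : ℝ, 0 < δ ∧ κ * (A * δ ^ 6) < 1 / 8 := by
    have h1 : Tendsto (fun δ : ℝ => κ * (A * δ ^ 6)) (𝓝[>] 0) (𝓝 0) := by
      have : Continuous fun δ : ℝ => κ * (A * δ ^ 6) := by fun_prop
      simpa using (this.tendsto 0).mono_left nhdsWithin_le_nhds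
    obtain ⟨δ, h2, h3⟩ := (eventually_mem_nhdsWithin.and
      (h1.eventually_lt_const (show (0 : ℝ) < 1 / 8 by norm_num))).exists
    exact ⟨δ, h2, h3⟩
  have hmeas : Tendsto (fun s => κ * ((δ ^ k)⁻¹ *
      volume.real (violationSet k c s u ∩ ball c R))) (𝓝 r) (𝓝 0) := by
    have h1 : Tendsto (fun s => volume (violationSet k c s u ∩ ball c R)) (𝓝 r)
        (𝓝 (volume (∅ : Set E))) := by
      refine tendsto_measure_of_ae_tendsto_indicator (𝓝 r) MeasurableSet.empty
        (fun s => (hu.measurableSet_violationSet c s).inter measurableSet_ball)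
        (measurableSet_ball (x := c) (ε := R)) measure_ball_lt_top.ne
        (Eventually.of_forall fun s => inter_subset_right) ?_
      have hsph : ∀ᵐ z : E, z ∉ sphere c r := measure_eq_zero_iff_ae_notMem.1
        (Measure.addHaar_sphere volume c r)
      filter_upwards [hsph, Measure.ae_ne volume 0] with z hz hz0
      suffices ∀ᶠ s in 𝓝 r, z ∉ violationSet k c s u by
        filter_upwards [this] with s hs
        simp [hs]
      rcases lt_or_gt_of_ne (show dist z c ≠ r from hz) with h | h
      · filter_upwards [Ioi_mem_nhds h] with s hs hmem
        exact lt_asymm hs hmem.1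
      · have hlt := hu.kelvin_lt hE hp hp1 hC hsing hr hrc hV h hz0
        filter_upwards [(continuousAt_kelvin_radius (k := k) hu.cont hr hrc h).eventually_lt_const hlt]
          with s hs hmem
        exact lt_asymm hs hmem.2.2
    rw [measure_empty] at h1
    have h2 := (ENNReal.tendsto_toReal ENNReal.zero_ne_top).comp h1
    simpa [Measure.real, Function.comp_def] using (h2.const_mul ((δ ^ k)⁻¹)).const_mul κ
  filter_upwards [hmeas.eventually_lt_const (show (0 : ℝ) < 1 / 8 by norm_num), Ioo_mem_nhds hr hrL]
    with s hs ⟨hs0, hsL⟩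
  set V := violationSet k c s u with hVdef
  have hmV : MeasurableSet V := hu.measurableSet_violationSet c s
  have hmVR := hmV.inter (measurableSet_ball (x := c) (ε := R))
  have hsub : V ⊆ (ball c s)ᶜ :=
    violationSet_subset.trans (compl_subset_compl.2 ball_subset_closedBall)
  have hint (x : E) := (htail x c s hs0).1.mono_set hsub
  refine hu.violationSet_eq_empty_of_small hE hp hp1 hC hs0 (hsL.trans hLc) hM0
    (fun z hz => hM z (closedBall_subset_closedBall hsL.le hz)) hint fun x => ?_
  have hnn : ∀ z : E, 0 ≤ (‖x - z‖ ^ k)⁻¹ * (‖z - c‖ ^ 12)⁻¹ := fun z => by positivity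
  have hfar : ∫ z in V \ ball c R, (‖x - z‖ ^ k)⁻¹ * (‖z - c‖ ^ 12)⁻¹ ≤ A * (R ^ 6)⁻¹ :=
    (setIntegral_mono_set (htail x c R hR).1 (Eventually.of_forall hnn)
      (LE.le.eventuallyLE fun z hz => hz.2)).trans (htail x c R hR).2
  have hinear := (hnear x δ hδ).1
  have hi1 : Integrable ((ball x δ).indicator fun z => (‖x - z‖ ^ k)⁻¹) :=
    (integrable_indicator_iff measurableSet_ball).2 hinear
  have hfin : volume (V ∩ ball c R) ≠ ⊤ :=
    ((measure_mono inter_subset_right).trans_lt measure_ball_lt_top).ne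
  have hi2 : IntegrableOn (fun _ : E => (δ ^ k)⁻¹) (V ∩ ball c R) := integrableOn_const hfin
  have hmid : s ^ 12 * ∫ z in V ∩ ball c R, (‖x - z‖ ^ k)⁻¹ * (‖z - c‖ ^ 12)⁻¹ ≤
      A * δ ^ 6 + (δ ^ k)⁻¹ * volume.real (V ∩ ball c R) := by
    rw [← integral_const_mul]
    calc _ ≤ ∫ z in V ∩ ball c R,
          ((ball x δ).indicator (fun z => (‖x - z‖ ^ k)⁻¹) z + (δ ^ k)⁻¹) := by
          refine setIntegral_mono_on (((hint x).mono_set inter_subset_left).const_mul _)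
            (hi1.integrableOn.add hi2) hmVR fun z hz => ?_
          have hzs : s < ‖z - c‖ := by rw [← dist_eq_norm]; exact hz.1.1
          have h1 : s ^ 12 * (‖z - c‖ ^ 12)⁻¹ ≤ 1 := by
            rw [mul_inv_le_iff₀ (by have := hs0.trans hzs; positivity), one_mul]
            gcongr
          have h2 : s ^ 12 * ((‖x - z‖ ^ k)⁻¹ * (‖z - c‖ ^ 12)⁻¹) ≤ (‖x - z‖ ^ k)⁻¹ := by
            rw [mul_left_comm]
            exact mul_le_of_le_one_right (by positivity) h1
          refine h2.trans ?_
          by_cases hz : z ∈ ball x δ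
          · rw [indicator_of_mem hz]
            have : 0 ≤ (δ ^ k)⁻¹ := by positivity
            linarith
          · rw [indicator_of_notMem hz, zero_add]
            have : δ ≤ ‖x - z‖ := by simpa [dist_eq_norm, norm_sub_rev] using hz
            gcongr
      _ = (∫ z in V ∩ ball c R, (ball x δ).indicator (fun z => (‖x - z‖ ^ k)⁻¹) z) +
          (δ ^ k)⁻¹ * volume.real (V ∩ ball c R) := by
          rw [integral_add hi1.integrableOn hi2, setIntegral_const, smul_eq_mul, mul_comm (δ ^ k)⁻¹]
      _ ≤ A * δ ^ 6 + (δ ^ k)⁻¹ * volume.real (V ∩ ball c R) := by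
          gcongr
          refine (setIntegral_le_integral hi1 (Eventually.of_forall
            (indicator_nonneg fun z _ => by positivity))).trans ?_
          rw [integral_indicator measurableSet_ball]
          exact (hnear x δ hδ).2
  rw [← integral_inter_add_sdiff (measurableSet_ball (x := c) (ε := R)) (hint x), mul_add (s ^ 12), mul_add]
  have h12 : s ^ 12 * ∫ z in V \ ball c R, (‖x - z‖ ^ k)⁻¹ * (‖z - c‖ ^ 12)⁻¹ ≤
      ‖c‖ ^ 12 * (A * (R ^ 6)⁻¹) := by
    have : s ≤ ‖c‖ := (hsL.trans hLc).le
    have := setIntegral_nonneg (μ := volume) (hmV.diff (measurableSet_ball (x := c) (ε := R))) fun z _ => hnn z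
    gcongr
  have := mul_le_mul_of_nonneg_left h12 hκ0
  have := mul_le_mul_of_nonneg_left hmid hκ0
  linarith

/-- The method of moving spheres. -/
lemma IsRieszSolution.violationSet_eq_empty (hE : finrank ℝ E = k + 6)
    (hp : p * k = k + 12) (hp1 : 1 ≤ p) (hC : 0 < C) (hu : IsRieszSolution k p C u)
    (hsing : ∀ M ε : ℝ, 0 < ε → ∃ x : E, x ≠ 0 ∧ ‖x‖ < ε ∧ M < u x)
    (hr : 0 < r) (hrc : r < ‖c‖) : violationSet k c r u = ∅ := by
  set G : Set ℝ := {s | s ∈ Ioo 0 ‖c‖ ∧ violationSet k c s u = ∅}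
  suffices Ioo 0 ‖c‖ ⊆ G from (this ⟨hr, hrc⟩).2
  have hc : c ≠ 0 := norm_pos_iff.1 (hr.trans hrc)
  refine isPreconnected_Ioo.subset_of_closure_inter_subset ?_ ?_ ?_
  · refine isOpen_iff_mem_nhds.2 fun s hs => ?_
    filter_upwards [isOpen_Ioo.mem_nhds hs.1,
      hu.eventually_violationSet_eq_empty hE hp hp1 hC hsing hs.1.1 hs.1.2 hs.2] with t h1 h2
    exact ⟨h1, h2⟩
  · obtain ⟨s, h1, h2⟩ := ((hu.eventually_violationSet_eq_empty_zero hE hp hp1 hC hc).and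
      (Ioo_mem_nhdsGT (norm_pos_iff.2 hc))).exists
    exact ⟨s, h2, h2, h1⟩
  · rintro s ⟨hs, hsI⟩
    refine ⟨hsI, eq_empty_of_forall_notMem fun z hz => ?_⟩
    have h1 : ∀ᶠ t in 𝓝 s, z ∈ violationSet k c t u := by
      filter_upwards [Iio_mem_nhds hz.1,
        (continuousAt_kelvin_radius (k := k) hu.cont hsI.1 hsI.2 hz.1).eventually_const_lt hz.2.2]
        with t h1 h2
      exact ⟨h1, hz.2.1, h2⟩
    obtain ⟨t, ht, htG⟩ := mem_closure_iff_nhds.1 hs _ h1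
    have ht : z ∈ violationSet k c t u := ht
    rw [htG.2] at ht
    exact ht

lemma IsRieszSolution.kelvin_norm_le (hE : finrank ℝ E = k + 6)
    (hp : p * k = k + 12) (hp1 : 1 ≤ p) (hC : 0 < C) (hu : IsRieszSolution k p C u)
    (hsing : ∀ M ε : ℝ, 0 < ε → ∃ x : E, x ≠ 0 ∧ ‖x‖ < ε ∧ M < u x)
    (hc : c ≠ 0) {z : E} (hz : z ≠ 0) (hzc : ‖c‖ < dist z c) : kelvin k c ‖c‖ u z ≤ u z := by
  have hc' : 0 < ‖c‖ := norm_pos_iff.2 hc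
  have hinv : inversion c ‖c‖ z ≠ 0 := by
    intro h
    have h0 : inversion c ‖c‖ (0 : E) = 0 :=
      inversion_of_mem_sphere (by simp)
    exact hz (inversion_injective c hc'.ne' (h.trans h0.symm))
  have hcont : ContinuousAt (fun r => kelvin k c r u z) ‖c‖ := by
    have h1 : ContinuousAt (fun r => inversion c r z) ‖c‖ :=
      ContinuousAt.inversion continuousAt_const continuousAt_id continuousAt_const
        (dist_pos.1 (hc'.trans hzc))
    have h2 : ContinuousAt u (inversion c ‖c‖ z) :=
      hu.cont.continuousAt (isOpen_compl_singleton.mem_nhds hinv)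
    exact ((continuousAt_id.div_const _).pow k).mul
      (ContinuousAt.comp (f := fun r => inversion c r z) (g := u) h2 h1)
  refine le_of_tendsto (hcont.tendsto.mono_left nhdsWithin_le_nhds :
    Tendsto _ (𝓝[<] ‖c‖) _) ?_
  filter_upwards [Ioo_mem_nhdsLT hc'] with s hs
  by_contra h
  have hmem : z ∈ violationSet k c s u := ⟨hs.2.trans hzc, hz, not_le.1 h⟩
  rw [hu.violationSet_eq_empty hE hp hp1 hC hsing hs.1 hs.2] at hmem
  exact hmem

lemma IsRieszSolution.le_of_norm_eq (hE : finrank ℝ E = k + 6)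
    (hp : p * k = k + 12) (hp1 : 1 ≤ p) (hC : 0 < C) (hu : IsRieszSolution k p C u)
    (hsing : ∀ M ε : ℝ, 0 < ε → ∃ x : E, x ≠ 0 ∧ ‖x‖ < ε ∧ M < u x)
    {x y : E} (hx : x ≠ 0) (hy : y ≠ 0) (hxy : ‖x‖ = ‖y‖) : u x ≤ u y := by
  rcases eq_or_ne x y with rfl | hne
  · rfl
  have hd : 0 < ‖x - y‖ := norm_pos_iff.2 (sub_ne_zero.2 hne)
  set e : E := ‖x - y‖⁻¹ • (x - y) with he
  have hen : ‖e‖ = 1 := by rw [he, norm_smul, norm_inv, norm_norm, inv_mul_cancel₀ hd.ne']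
  set a : ℝ := inner ℝ y e with ha
  have hae : a = -‖x - y‖ / 2 := by
    have h1 := norm_sub_sq_real x y
    have h2 : a = ‖x - y‖⁻¹ * (inner ℝ x y - ‖y‖ ^ 2) := by
      rw [ha, he, real_inner_smul_right, inner_sub_right, real_inner_self_eq_norm_sq,
        real_inner_comm]
    rw [h2, inv_mul_eq_div, div_eq_iff hd.ne']
    rw [hxy] at h1
    nlinarith
  have hneg : a < 0 := by rw [hae]; linarith
  have hx' : y - (2 * a) • e = x := by
    rw [hae, he, smul_smul]
    field_simp
    simp
  set D : ℝ → ℝ := fun s => 1 - 2 * s * a + s ^ 2 * ‖y‖ ^ 2 with hD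
  have hDnorm : ∀ s, ‖s • y - e‖ ^ 2 = D s := fun s => by
    rw [norm_sub_sq_real, norm_smul, real_inner_smul_left, hen, mul_pow, norm_eq_abs, sq_abs]
    ring
  have hDpos : ∀ s, 0 < s → 1 < D s := fun s hs => by
    have h1 := mul_pos hs (neg_pos.2 hneg)
    have h2 : 0 ≤ s ^ 2 * ‖y‖ ^ 2 := by positivity
    simp only [hD]
    linarith
  set G : ℝ → E := fun s => (D s)⁻¹ • y + ((-2 * a + s * ‖y‖ ^ 2) / D s) • e with hG
  have hdist : ∀ s, 0 < s → dist y (s⁻¹ • e) = s⁻¹ * ‖s • y - e‖ := fun s hs => by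
    have h : y - s⁻¹ • e = s⁻¹ • (s • y - e) := by
      rw [smul_sub s⁻¹, inv_smul_smul₀ hs.ne']
    rw [dist_eq_norm, h, norm_smul, norm_of_nonneg (inv_pos.2 hs).le]
  have hcn : ∀ s, 0 < s → ‖s⁻¹ • e‖ = s⁻¹ := fun s hs => by
    rw [norm_smul, hen, mul_one, norm_of_nonneg (by positivity)]
  have hinv : ∀ s, 0 < s → inversion (s⁻¹ • e) s⁻¹ y = G s := fun s hs => by
    have hDs := zero_lt_one.trans (hDpos s hs)
    have h2 : (s⁻¹ / dist y (s⁻¹ • e)) ^ 2 = (D s)⁻¹ := by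
      rw [hdist s hs, div_pow, mul_pow, hDnorm]
      field_simp
    simp only [inversion, vsub_eq_sub, vadd_eq_add, h2, hG]
    rw [smul_sub, smul_smul, sub_add_eq_add_sub, add_sub_assoc, ← sub_smul]
    congr 2
    have : D s - 1 = s * (-2 * a + s * ‖y‖ ^ 2) := by simp only [hD]; ring
    field_simp
    linarith
  have hle : ∀ s, 0 < s → (‖s • y - e‖⁻¹) ^ k * u (G s) ≤ u y := fun s hs => by
    have hc : s⁻¹ • e ≠ 0 := by
      rw [← norm_pos_iff, hcn s hs]; positivity
    have hlt : ‖s⁻¹ • e‖ < dist y (s⁻¹ • e) := by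
      rw [hcn s hs, hdist s hs]
      refine lt_mul_of_one_lt_right (by positivity) ?_
      refine lt_of_pow_lt_pow_left₀ 2 (norm_nonneg _) ?_
      rw [hDnorm, one_pow]
      exact hDpos s hs
    have h := hu.kelvin_norm_le hE hp hp1 hC hsing hc hy hlt
    rw [kelvin, hcn s hs, hinv s hs, hdist s hs] at h
    convert h using 3
    field_simp
  have hD0 : D 0 = 1 := by simp [hD]
  have hDc : Continuous D := by fun_prop
  have hG0 : G 0 = x := by
    rw [← hx']
    simp only [hG, hD0]
    simp [sub_eq_add_neg]
  have hGc : ContinuousAt G 0 := by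
    have h0 : D 0 ≠ 0 := by rw [hD0]; exact one_ne_zero
    exact ((hDc.continuousAt.inv₀ h0).smul continuousAt_const).add
      (ContinuousAt.smul (ContinuousAt.div (by fun_prop) hDc.continuousAt h0) continuousAt_const)
  have hlim : Tendsto (fun s : ℝ => (‖s • y - e‖⁻¹) ^ k * u (G s)) (𝓝[>] 0) (𝓝 (u x)) := by
    have hux : ContinuousAt u (G 0) := by
      rw [hG0]; exact hu.cont.continuousAt (isOpen_compl_singleton.mem_nhds hx)
    have h1 : ContinuousAt (fun s : ℝ => (‖s • y - e‖⁻¹) ^ k) 0 := by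
      refine (ContinuousAt.inv₀ (by fun_prop) ?_).pow k
      simp [hen]
    have h2 : ContinuousAt (fun s : ℝ => (‖s • y - e‖⁻¹) ^ k * u (G s)) 0 :=
      h1.mul (ContinuousAt.comp (f := G) (g := u) hux hGc)
    have h3 := h2.tendsto.mono_left (nhdsWithin_le_nhds (s := Ioi 0))
    simpa [hG0, hen] using h3
  exact le_of_tendsto hlim (eventually_mem_nhdsWithin.mono fun s hs => hle s hs)

end MovingSpheres

section DirectionalLaplacian

open scoped ContDiff

variable {V W ι : Type*} [NormedAddCommGroup V] [NormedSpace ℝ V] [NormedAddCommGroup W]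
  [NormedSpace ℝ W] [Fintype ι] {v : ι → V} {f g : V → ℝ} {Ω : Set V} {x : V}

/-- The sum of the second derivatives along a family of directions. -/
def lap (v : ι → V) (f : V → ℝ) (x : V) : ℝ :=
  ∑ i, fderiv ℝ (fun y => fderiv ℝ f y (v i)) x (v i)

/-- The third iterate of `lap`. -/
def trilap (v : ι → V) (f : V → ℝ) : V → ℝ := lap v (lap v (lap v f))

lemma ContDiffOn.fderiv_apply_const {m m' : WithTop ℕ∞} (hf : ContDiffOn ℝ m' f Ω)
    (hΩ : IsOpen Ω) (hm : m + 1 ≤ m') (w : V) : ContDiffOn ℝ m (fun y => fderiv ℝ f y w) Ω :=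
  (hf.fderiv_of_isOpen hΩ hm).clm_apply contDiffOn_const

lemma ContDiffOn.lap {m m' : WithTop ℕ∞} (hf : ContDiffOn ℝ m' f Ω) (hΩ : IsOpen Ω)
    (hm : m + 1 + 1 ≤ m') (v : ι → V) : ContDiffOn ℝ m (lap v f) Ω :=
  ContDiffOn.sum fun i _ => (hf.fderiv_apply_const hΩ hm (v i)).fderiv_apply_const hΩ le_rfl (v i)

lemma ContDiffOn.trilap {m m' : WithTop ℕ∞} (hf : ContDiffOn ℝ m' f Ω) (hΩ : IsOpen Ω)
    (hm : m + 1 + 1 + 1 + 1 + 1 + 1 ≤ m') (v : ι → V) : ContDiffOn ℝ m (trilap v f) Ω :=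
  ((hf.lap hΩ hm v).lap hΩ le_rfl v).lap hΩ le_rfl v

lemma ContDiff.trilap {m m' : WithTop ℕ∞} (hf : ContDiff ℝ m' f)
    (hm : m + 1 + 1 + 1 + 1 + 1 + 1 ≤ m') (v : ι → V) : ContDiff ℝ m (trilap v f) :=
  contDiffOn_univ.1 ((contDiffOn_univ.2 hf).trilap isOpen_univ hm v)

lemma Filter.EventuallyEq.lap (h : f =ᶠ[𝓝 x] g) (v : ι → V) : lap v f =ᶠ[𝓝 x] lap v g := by
  filter_upwards [h.eventuallyEq_nhds] with y hy
  refine Finset.sum_congr rfl fun i _ => ?_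
  have : (fun z => fderiv ℝ f z (v i)) =ᶠ[𝓝 y] fun z => fderiv ℝ g z (v i) := by
    filter_upwards [hy.fderiv (𝕜 := ℝ)] with z hz
    rw [hz]
  rw [this.fderiv_eq]

lemma Filter.EventuallyEq.trilap (h : f =ᶠ[𝓝 x] g) (v : ι → V) :
    trilap v f =ᶠ[𝓝 x] trilap v g := ((h.lap v).lap v).lap v

lemma lap_const_mul (v : ι → V) (c : ℝ) (f : V → ℝ) :
    lap v (fun y => c * f y) = fun y => c * lap v f y := by
  have key : ∀ (h : V → ℝ) (w : V), (fun y => fderiv ℝ (fun z => c * h z) y w) =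
      fun y => c * fderiv ℝ h y w := fun h w => by
    ext y
    have := congrFun (fderiv_const_smul_field (𝕜 := ℝ) (f := h) c) y
    rw [show (fun z => c * h z) = c • h from rfl, this]
    rfl
  ext x
  simp only [lap, Finset.mul_sum, key]
  exact Finset.sum_congr rfl fun i _ => congrFun (key (fun y => fderiv ℝ f y (v i)) (v i)) x

lemma trilap_const_mul (v : ι → V) (c : ℝ) (f : V → ℝ) :
    trilap v (fun y => c * f y) = fun y => c * trilap v f y := by
  simp only [trilap, lap_const_mul]

lemma lap_comp_smul (v : ι → V) (f : V → ℝ) (a : ℝ) :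
    lap v (fun y => f (a • y)) = fun y => a ^ 2 * lap v f (a • y) := by
  have key : ∀ (h : V → ℝ) (w y : V), fderiv ℝ (fun z => h (a • z)) y w =
      a * fderiv ℝ h (a • y) w := fun h w y => by
    rw [fderiv_comp_smul]
    rfl
  ext x
  simp only [lap, Finset.mul_sum, key]
  refine Finset.sum_congr rfl fun i _ => ?_
  have := congrFun (fderiv_const_smul_field (𝕜 := ℝ)
    (f := fun y => fderiv ℝ f (a • y) (v i)) a) x
  rw [show (fun y => a * fderiv ℝ f (a • y) (v i)) = a • fun y => fderiv ℝ f (a • y) (v i) from rfl,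
    this]
  simp only [Pi.smul_apply, smul_apply, smul_eq_mul,
    key (fun y => fderiv ℝ f y (v i))]
  ring

lemma trilap_comp_smul (v : ι → V) (f : V → ℝ) (a : ℝ) :
    trilap v (fun y => f (a • y)) = fun y => a ^ 6 * trilap v f (a • y) := by
  simp only [trilap, lap_comp_smul, lap_const_mul]
  ext y
  ring

lemma tsupport_lap_subset (v : ι → V) (f : V → ℝ) : tsupport (lap v f) ⊆ tsupport f := by
  refine closure_minimal (fun x hx => ?_) (isClosed_tsupport f)
  by_contra h
  have h0 : f =ᶠ[𝓝 x] fun _ => 0 := notMem_tsupport_iff_eventuallyEq.1 h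
  exact hx ((h0.lap v).eq_of_nhds.trans (by simp [lap]))

lemma tsupport_trilap_subset (v : ι → V) (f : V → ℝ) : tsupport (trilap v f) ⊆ tsupport f :=
  ((tsupport_lap_subset v _).trans (tsupport_lap_subset v _)).trans (tsupport_lap_subset v _)

/-- The directional Laplacian of a slice is a slice of the directional Laplacian. -/
lemma lap_slice {F : W × V → ℝ} {t : W} {D : Set (W × V)} (hD : IsOpen D)
    (hF : ContDiffOn ℝ 2 F D) (hx : (t, x) ∈ D) (v : ι → V) :
    lap v (fun y => F (t, y)) x = lap (fun i => ((0 : W), v i)) F (t, x) := by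
  have key : ∀ {h : W × V → ℝ} {y : V} (w : V), DifferentiableAt ℝ h (t, y) →
      fderiv ℝ (fun z => h (t, z)) y w = fderiv ℝ h (t, y) (0, w) := fun {h y} w hd => by
    have h1 : HasFDerivAt (fun z : V => (t, z)) (ContinuousLinearMap.inr ℝ W V) y :=
      hasFDerivAt_prodMk_right t y
    have h2 : HasFDerivAt (fun z : V => h (t, z))
        ((fderiv ℝ h (t, y)).comp (ContinuousLinearMap.inr ℝ W V)) y := hd.hasFDerivAt.comp y h1
    rw [h2.fderiv]
    simp
  refine Finset.sum_congr rfl fun i _ => ?_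
  have hcont : ContinuousAt (fun z : V => (t, z)) x := by fun_prop
  have h1 : (fun y => fderiv ℝ (fun z => F (t, z)) y (v i)) =ᶠ[𝓝 x]
      fun y => fderiv ℝ F (t, y) (0, v i) := by
    filter_upwards [hcont.preimage_mem_nhds (hD.mem_nhds hx)] with y hy
    exact key _ ((hF.differentiableOn (by norm_num)).differentiableAt (hD.mem_nhds hy))
  rw [h1.fderiv_eq]
  refine key (h := fun q => fderiv ℝ F q (0, v i)) _ ?_
  exact ((hF.fderiv_apply_const (m := 1) hD (by norm_num) _).differentiableOn
    (by norm_num)).differentiableAt (hD.mem_nhds hx)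

lemma trilap_slice {F : W × V → ℝ} {t : W} {D : Set (W × V)} (hD : IsOpen D)
    (hF : ContDiffOn ℝ ∞ F D) (hx : (t, x) ∈ D) (v : ι → V) :
    trilap v (fun y => F (t, y)) x = trilap (fun i => ((0 : W), v i)) F (t, x) := by
  have h1 := hF.lap hD (m := ∞) (by simp) fun i => ((0 : W), v i)
  have h2 := h1.lap hD (m := ∞) (by simp) fun i => ((0 : W), v i)
  have hle : (2 : WithTop ℕ∞) ≤ ∞ := by
    exact WithTop.coe_le_coe.2 (le_top : (2 : ℕ∞) ≤ ⊤)
  have hnhds : ∀ {y : V}, (t, y) ∈ D → ∀ᶠ z in 𝓝 y, (t, z) ∈ D := fun {y} hy =>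
    (show ContinuousAt (fun z : V => (t, z)) y by fun_prop).preimage_mem_nhds (hD.mem_nhds hy)
  have e1 : ∀ {y : V}, (t, y) ∈ D → lap v (fun y => F (t, y)) =ᶠ[𝓝 y]
      fun y => lap (fun i => ((0 : W), v i)) F (t, y) := fun {y} hy => by
    filter_upwards [hnhds hy] with z hz
    exact lap_slice hD (hF.of_le hle) hz v
  have e2 : lap v (lap v fun y => F (t, y)) =ᶠ[𝓝 x] fun y =>
      lap (fun i => ((0 : W), v i)) (lap (fun i => ((0 : W), v i)) F) (t, y) := by
    filter_upwards [hnhds hx] with z hz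
    rw [((e1 hz).lap v).eq_of_nhds]
    exact lap_slice hD (h1.of_le hle) hz v
  unfold trilap
  rw [(e2.lap v).eq_of_nhds]
  exact lap_slice hD (h2.of_le hle) hx v

lemma exists_trilap_slice_bound {F : W × V → ℝ} {D K : Set (W × V)} (hD : IsOpen D)
    (hF : ContDiffOn ℝ ∞ F D) (hK : IsCompact K) (hKD : K ⊆ D) (v : ι → V) :
    ∃ C, 0 < C ∧ ∀ t x, (t, x) ∈ K → |trilap v (fun y => F (t, y)) x| ≤ C := by
  have h := (hF.trilap hD (m := ∞) (by simp) fun i => ((0 : W), v i)).continuousOn.mono hKD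
  obtain ⟨C, hC⟩ := hK.exists_bound_of_continuousOn h
  refine ⟨max C 1, by positivity, fun t x hx => ?_⟩
  rw [trilap_slice hD hF (hKD hx)]
  exact (hC _ hx).trans (le_max_left _ _)

end DirectionalLaplacian

section CompactSupport

variable {V ι : Type*} [NormedAddCommGroup V] [NormedSpace ℝ V] [Fintype ι] {g : V → ℝ}

lemma HasCompactSupport.lap (hc : HasCompactSupport g) (v : ι → V) :
    HasCompactSupport (lap v g) := hc.of_isClosed_subset isClosed_closure (tsupport_lap_subset v g)

lemma HasCompactSupport.trilap (hc : HasCompactSupport g) (v : ι → V) :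
    HasCompactSupport (trilap v g) := ((hc.lap v).lap v).lap v

end CompactSupport

section IntegrationByParts

variable {V ι : Type*} [NormedAddCommGroup V] [NormedSpace ℝ V] [FiniteDimensional ℝ V]
  [MeasureSpace V] [BorelSpace V] [(volume : Measure V).IsAddHaarMeasure] [Fintype ι]
  {f g : V → ℝ}

lemma integral_mul_fderiv_apply (hf : ContDiff ℝ 1 f) (hg : ContDiff ℝ 1 g)
    (hc : HasCompactSupport g) (w : V) :
    ∫ x, f x * fderiv ℝ g x w = -∫ x, fderiv ℝ f x w * g x := by
  have hf' : Continuous fun x => fderiv ℝ f x w :=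
    (hf.continuous_fderiv (by norm_num)).clm_apply continuous_const
  have hg' : Continuous fun x => fderiv ℝ g x w :=
    (hg.continuous_fderiv (by norm_num)).clm_apply continuous_const
  refine integral_mul_fderiv_eq_neg_fderiv_mul_of_integrable ?_ ?_ ?_
    (fun x _ => hf.differentiable (by norm_num) x) (fun x _ => hg.differentiable (by norm_num) x)
  · exact (hf'.mul hg.continuous).integrable_of_hasCompactSupport hc.mul_left
  · exact (hf.continuous.mul hg').integrable_of_hasCompactSupport (hc.fderiv_apply ℝ w).mul_left
  · exact (hf.continuous.mul hg.continuous).integrable_of_hasCompactSupport hc.mul_left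

lemma integral_mul_lap (hf : ContDiff ℝ 2 f) (hg : ContDiff ℝ 2 g)
    (hc : HasCompactSupport g) (v : ι → V) :
    ∫ x, f x * lap v g x = ∫ x, lap v f x * g x := by
  have hd : ∀ {h : V → ℝ}, ContDiff ℝ 2 h → ∀ w, ContDiff ℝ 1 fun x => fderiv ℝ h x w :=
    fun hh w => (hh.fderiv_right (by norm_num)).clm_apply contDiff_const
  have hd' : ∀ {h : V → ℝ}, ContDiff ℝ 2 h → ∀ w,
      Continuous fun x => fderiv ℝ (fun y => fderiv ℝ h y w) x w := fun hh w =>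
    ((hd hh w).continuous_fderiv (by norm_num)).clm_apply continuous_const
  have h12 : (1 : WithTop ℕ∞) ≤ 2 := by norm_num
  simp only [lap, Finset.mul_sum, Finset.sum_mul]
  rw [integral_finsetSum, integral_finsetSum]
  · refine Finset.sum_congr rfl fun i _ => ?_
    have h1 := integral_mul_fderiv_apply (hf.of_le h12) (hd hg (v i)) (hc.fderiv_apply ℝ (v i))
      (v i)
    have h2 := integral_mul_fderiv_apply (hd hf (v i)) (hg.of_le h12) hc (v i)
    rw [h1, h2, neg_neg]
  · exact fun i _ => ((hd' hf (v i)).mul hg.continuous).integrable_of_hasCompactSupport hc.mul_left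
  · exact fun i _ => (hf.continuous.mul (hd' hg (v i))).integrable_of_hasCompactSupport
      ((hc.fderiv_apply ℝ (v i)).fderiv_apply ℝ (v i)).mul_left

lemma integral_mul_trilap (hf : ContDiff ℝ 6 f) (hg : ContDiff ℝ 6 g)
    (hc : HasCompactSupport g) (v : ι → V) :
    ∫ x, f x * trilap v g x = ∫ x, trilap v f x * g x := by
  have hl : ∀ {h : V → ℝ} {m m' : WithTop ℕ∞}, m + 1 + 1 ≤ m' → ContDiff ℝ m' h →
      ContDiff ℝ m (_root_.lap v h) := fun hm hh =>
    contDiffOn_univ.1 ((contDiffOn_univ.2 hh).lap isOpen_univ hm v)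
  have h42 : (4 : WithTop ℕ∞) + 1 + 1 ≤ 6 := by norm_num
  have h22 : (2 : WithTop ℕ∞) + 1 + 1 ≤ 4 := by norm_num
  have h24 : (2 : WithTop ℕ∞) ≤ 4 := by norm_num
  have h26 : (2 : WithTop ℕ∞) ≤ 6 := by norm_num
  unfold _root_.trilap
  rw [integral_mul_lap (hf.of_le h26) (hl h22 (hl h42 hg)) ((hc.lap v).lap v),
    integral_mul_lap ((hl h42 hf).of_le h24) ((hl h42 hg).of_le h24) (hc.lap v),
    integral_mul_lap (hl h22 (hl h42 hf)) (hg.of_le h26) hc]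

end IntegrationByParts

section EuclideanLaplacian

variable {n : ℕ}

/-- The standard basis vectors. -/
abbrev stdVec (n : ℕ) (i : Fin n) : EuclideanSpace ℝ (Fin n) := EuclideanSpace.single i 1

lemma sum_inner_stdVec_sq (y : EuclideanSpace ℝ (Fin n)) :
    ∑ i, inner ℝ y (stdVec n i) ^ 2 = ‖y‖ ^ 2 := by
  simp [EuclideanSpace.norm_sq_eq, EuclideanSpace.inner_single_right]

lemma laplacian_eq_lap {u : EuclideanSpace ℝ (Fin n) → ℝ} {x : EuclideanSpace ℝ (Fin n)}
    (hu : ContDiffAt ℝ 2 u x) : laplacian u x = lap (stdVec n) u x := by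
  refine Finset.sum_congr rfl fun i _ => ?_
  have hd : DifferentiableAt ℝ (fderiv ℝ u) x :=
    (hu.fderiv_right (m := 1) (by norm_num)).differentiableAt (by norm_num)
  rw [iteratedFDeriv_two_apply, fderiv_clm_apply hd (differentiableAt_const _)]
  simp

lemma Filter.EventuallyEq.laplacian_eq {u w : EuclideanSpace ℝ (Fin n) → ℝ}
    {x : EuclideanSpace ℝ (Fin n)} (h : u =ᶠ[𝓝 x] w) : laplacian u x = laplacian w x := by
  unfold laplacian
  rw [(h.iteratedFDeriv ℝ 2).eq_of_nhds]

lemma laplacian_laplacian_laplacian_eq_trilap {u : EuclideanSpace ℝ (Fin n) → ℝ}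
    {Ω : Set (EuclideanSpace ℝ (Fin n))} (hΩ : IsOpen Ω) (hu : ContDiffOn ℝ 6 u Ω)
    {x : EuclideanSpace ℝ (Fin n)} (hx : x ∈ Ω) :
    laplacian (laplacian (laplacian u)) x = trilap (stdVec n) u x := by
  have h4 : ContDiffOn ℝ 4 (lap (stdVec n) u) Ω := hu.lap hΩ (by norm_num) _
  have h2 : ContDiffOn ℝ 2 (lap (stdVec n) (lap (stdVec n) u)) Ω := h4.lap hΩ (by norm_num) _
  have e1 : ∀ y ∈ Ω, laplacian u =ᶠ[𝓝 y] lap (stdVec n) u := fun y hy => by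
    filter_upwards [hΩ.mem_nhds hy] with z hz
    exact laplacian_eq_lap ((hu.contDiffAt (hΩ.mem_nhds hz)).of_le (by norm_num))
  have e2 : laplacian (laplacian u) =ᶠ[𝓝 x] lap (stdVec n) (lap (stdVec n) u) := by
    filter_upwards [hΩ.mem_nhds hx] with z hz
    rw [(e1 z hz).laplacian_eq]
    exact laplacian_eq_lap ((h4.contDiffAt (hΩ.mem_nhds hz)).of_le (by norm_num))
  rw [e2.laplacian_eq]
  exact laplacian_eq_lap (h2.contDiffAt (hΩ.mem_nhds hx))

lemma lap_add {V ι : Type*} [NormedAddCommGroup V] [NormedSpace ℝ V] [Fintype ι] {f g : V → ℝ}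
    (hf : ContDiff ℝ 2 f) (hg : ContDiff ℝ 2 g) (v : ι → V) :
    lap v (fun y => f y + g y) = fun y => lap v f y + lap v g y := by
  have hd : ∀ {h : V → ℝ}, ContDiff ℝ 2 h → ∀ w, ContDiff ℝ 1 fun x => fderiv ℝ h x w :=
    fun hh w => (hh.fderiv_right (by norm_num)).clm_apply contDiff_const
  ext x
  simp only [lap, ← Finset.sum_add_distrib]
  refine Finset.sum_congr rfl fun i _ => ?_
  have h1 : (fun y => fderiv ℝ (fun z => f z + g z) y (v i)) =
      fun y => fderiv ℝ f y (v i) + fderiv ℝ g y (v i) := by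
    ext y
    rw [fderiv_fun_add (hf.differentiable (by norm_num) y) (hg.differentiable (by norm_num) y)]
    rfl
  rw [h1, fderiv_fun_add ((hd hf _).differentiable (by norm_num) x)
    ((hd hg _).differentiable (by norm_num) x)]
  rfl

variable {x : EuclideanSpace ℝ (Fin n)} {δ : ℝ}

lemma contDiff_bubble (x : EuclideanSpace ℝ (Fin n)) (hδ : 0 < δ) (b : ℝ) {m : WithTop ℕ∞} :
    ContDiff ℝ m fun y => (‖x - y‖ ^ 2 + δ ^ 2) ^ b := by
  have h : ContDiff ℝ m fun y => ‖x - y‖ ^ 2 + δ ^ 2 :=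
    ((contDiff_const.sub contDiff_id).norm_sq ℝ).add contDiff_const
  exact h.rpow_const_of_ne fun y => by positivity

lemma lap_bubble (x : EuclideanSpace ℝ (Fin n)) (hδ : 0 < δ) (b : ℝ) :
    lap (stdVec n) (fun y => (‖x - y‖ ^ 2 + δ ^ 2) ^ b) = fun y =>
      2 * b * (2 * b - 2 + n) * (‖x - y‖ ^ 2 + δ ^ 2) ^ (b - 1) +
        -(4 * b * (b - 1) * δ ^ 2) * (‖x - y‖ ^ 2 + δ ^ 2) ^ (b - 2) := by
  have hs : ∀ y, HasFDerivAt (fun y => ‖x - y‖ ^ 2 + δ ^ 2) ((-2 : ℝ) • innerSL ℝ (x - y)) y :=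
    fun y => by
      refine ((((hasFDerivAt_id y).const_sub x).norm_sq).add_const (δ ^ 2)).congr_fderiv ?_
      ext w
      simp
      ring
  have hpos : ∀ y, 0 < ‖x - y‖ ^ 2 + δ ^ 2 := fun y => by positivity
  have hD : ∀ (b : ℝ) (w y : EuclideanSpace ℝ (Fin n)),
      HasFDerivAt (fun z => (‖x - z‖ ^ 2 + δ ^ 2) ^ b)
        ((b * (‖x - y‖ ^ 2 + δ ^ 2) ^ (b - 1)) • ((-2 : ℝ) • innerSL ℝ (x - y))) y := fun b w y =>
    (hs y).rpow_const (Or.inl (hpos y).ne')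
  ext y
  have hfirst : ∀ w, (fun z => fderiv ℝ (fun y => (‖x - y‖ ^ 2 + δ ^ 2) ^ b) z w) =
      fun z => (-2 * b) * ((‖x - z‖ ^ 2 + δ ^ 2) ^ (b - 1) * inner ℝ (x - z) w) := fun w => by
    ext z
    rw [(hD b w z).fderiv]
    simp [inner_sub_left]
    ring
  have hinner : ∀ w, HasFDerivAt (fun z => inner ℝ (x - z) w) (-innerSL ℝ w) y := fun w => by
    refine (((hasFDerivAt_id y).const_sub x).inner ℝ (hasFDerivAt_const w y)).congr_fderiv ?_
    ext z
    simp [real_inner_comm]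
  have hsecond : ∀ w, fderiv ℝ (fun z => fderiv ℝ (fun y => (‖x - y‖ ^ 2 + δ ^ 2) ^ b) z w) y w =
      4 * b * (b - 1) * (‖x - y‖ ^ 2 + δ ^ 2) ^ (b - 2) * inner ℝ (x - y) w ^ 2 +
        2 * b * (‖x - y‖ ^ 2 + δ ^ 2) ^ (b - 1) * ‖w‖ ^ 2 := fun w => by
    rw [hfirst w, (((hD (b - 1) w y).fun_mul (hinner w)).const_mul (-2 * b)).fderiv]
    simp [show b - 1 - 1 = b - 2 by ring, inner_sub_left]
    ring
  simp only [lap, hsecond, Finset.sum_add_distrib, ← Finset.mul_sum, sum_inner_stdVec_sq]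
  have h1 : (‖x - y‖ ^ 2 + δ ^ 2) ^ (b - 1) =
      (‖x - y‖ ^ 2 + δ ^ 2) ^ (b - 2) * (‖x - y‖ ^ 2 + δ ^ 2) := by
    rw [← rpow_add_one (hpos y).ne']
    congr 1
    ring
  simp [h1]
  ring

lemma trilap_bubble {k : ℕ} (hn : n = k + 6) (x : EuclideanSpace ℝ (Fin n)) (hδ : 0 < δ)
    {a : ℝ} (ha : a = -k / 2) :
    trilap (stdVec n) (fun y => (‖x - y‖ ^ 2 + δ ^ 2) ^ a) = fun y =>
      -(64 * (a * (a - 1) * (a - 2) * (a - 3) * (a - 4) * (a - 5))) * δ ^ 6 *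
        (‖x - y‖ ^ 2 + δ ^ 2) ^ (a - 6) := by
  have hk : (n : ℝ) = -2 * a + 6 := by
    rw [hn, ha]
    push_cast
    ring
  have hc : ∀ c b : ℝ, ContDiff ℝ 2 fun y => c * (‖x - y‖ ^ 2 + δ ^ 2) ^ b := fun c b =>
    contDiff_const.mul (contDiff_bubble x hδ b)
  unfold trilap
  rw [lap_bubble x hδ a, lap_add (hc _ _) (hc _ _), lap_const_mul, lap_const_mul,
    lap_bubble x hδ, lap_bubble x hδ]
  have e : (fun y => 2 * a * (2 * a - 2 + n) * (2 * (a - 1) * (2 * (a - 1) - 2 + n) *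
        (‖x - y‖ ^ 2 + δ ^ 2) ^ (a - 1 - 1) +
        -(4 * (a - 1) * (a - 1 - 1) * δ ^ 2) * (‖x - y‖ ^ 2 + δ ^ 2) ^ (a - 1 - 2)) +
      -(4 * a * (a - 1) * δ ^ 2) * (2 * (a - 2) * (2 * (a - 2) - 2 + n) *
        (‖x - y‖ ^ 2 + δ ^ 2) ^ (a - 2 - 1) +
        -(4 * (a - 2) * (a - 2 - 1) * δ ^ 2) * (‖x - y‖ ^ 2 + δ ^ 2) ^ (a - 2 - 2))) =
      fun y => 32 * a * (a - 1) * (‖x - y‖ ^ 2 + δ ^ 2) ^ (a - 2) +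
        (-(32 * a * (a - 1) * (a - 2) * δ ^ 2) * (‖x - y‖ ^ 2 + δ ^ 2) ^ (a - 3) +
        16 * a * (a - 1) * (a - 2) * (a - 3) * δ ^ 4 * (‖x - y‖ ^ 2 + δ ^ 2) ^ (a - 4)) := by
    ext y
    rw [hk, show a - 1 - 1 = a - 2 by ring, show a - 1 - 2 = a - 3 by ring,
      show a - 2 - 1 = a - 3 by ring, show a - 2 - 2 = a - 4 by ring]
    ring
  rw [e, lap_add (hc _ _) ((hc _ _).add (hc _ _)), lap_add (hc _ _) (hc _ _), lap_const_mul,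
    lap_const_mul, lap_const_mul, lap_bubble x hδ, lap_bubble x hδ, lap_bubble x hδ]
  ext y
  rw [hk, show a - 2 - 1 = a - 3 by ring, show a - 2 - 2 = a - 4 by ring,
    show a - 3 - 1 = a - 4 by ring, show a - 3 - 2 = a - 5 by ring,
    show a - 4 - 1 = a - 5 by ring, show a - 4 - 2 = a - 6 by ring]
  ring

end EuclideanLaplacian

section WeakFormulation

open scoped ContDiff

variable {k : ℕ} {p c : ℝ} {u ψ φ : EuclideanSpace ℝ (Fin (k + 6)) → ℝ}

/-- A positive solution of the equation of order six on the punctured space. -/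
structure IsPuncturedSolution (k : ℕ) (p c : ℝ) (u : EuclideanSpace ℝ (Fin (k + 6)) → ℝ) :
    Prop where
  pos : ∀ x ≠ 0, 0 < u x
  contDiffOn : ContDiffOn ℝ 6 u {0}ᶜ
  eq : ∀ x ≠ 0, trilap (stdVec (k + 6)) u x = -(c * u x ^ p)

lemma IsPuncturedSolution.continuousOn (hu : IsPuncturedSolution k p c u) :
    ContinuousOn u {0}ᶜ := hu.contDiffOn.continuousOn

lemma IsPuncturedSolution.continuousOn_rpow (hu : IsPuncturedSolution k p c u) :
    ContinuousOn (fun x => u x ^ p) {0}ᶜ :=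
  hu.continuousOn.rpow_const fun x hx => Or.inl (hu.pos x hx).ne'

lemma integrable_mul_of_zero_notMem_tsupport {f g : EuclideanSpace ℝ (Fin (k + 6)) → ℝ}
    (hf : ContinuousOn f {0}ᶜ) (hg : Continuous g) (hc : HasCompactSupport g)
    (h0 : 0 ∉ tsupport g) : Integrable fun x => f x * g x := by
  have h : IntegrableOn (fun x => f x * g x) (tsupport g) :=
    ((hf.mono fun x hx => by rintro rfl; exact h0 hx).mul hg.continuousOn).integrableOn_compact hc
  refine (integrableOn_iff_integrable_of_support_subset fun x hx => subset_tsupport g ?_).1 h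
  exact right_ne_zero_of_mul hx

/-- The distributional equation against test functions supported away from the origin. -/
lemma IsPuncturedSolution.integral_mul_trilap_of_notMem (hu : IsPuncturedSolution k p c u)
    (hψ : ContDiff ℝ 6 ψ) (hc : HasCompactSupport ψ) (h0 : 0 ∉ tsupport ψ) :
    ∫ x, u x * trilap (stdVec (k + 6)) ψ x = -(c * ∫ x, u x ^ p * ψ x) := by
  obtain ⟨r, hr, hball⟩ := Metric.isOpen_iff.1 (isClosed_tsupport ψ).isOpen_compl 0 h0
  let η : ContDiffBump (0 : EuclideanSpace ℝ (Fin (k + 6))) := ⟨r / 3, r / 2, by positivity,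
    by linarith⟩
  set w : EuclideanSpace ℝ (Fin (k + 6)) → ℝ := fun x => (1 - η x) * u x with hw
  have hwC : ContDiff ℝ 6 w := contDiff_iff_contDiffAt.2 fun x => by
    by_cases hx : x = 0
    · have : w =ᶠ[𝓝 x] fun _ => 0 := by
        subst hx
        filter_upwards [η.eventuallyEq_one] with y hy
        simp only [hw, hy]
        simp
      exact contDiffAt_const.congr_of_eventuallyEq this
    · exact (contDiffAt_const.sub η.contDiffAt).mul
        (hu.contDiffOn.contDiffAt (isOpen_compl_singleton.mem_nhds hx))
  have hwu : ∀ x ∈ tsupport ψ, w =ᶠ[𝓝 x] u := fun x hx => by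
    have : x ∉ tsupport η := by
      rw [η.tsupport_eq]
      exact fun h => hball (closedBall_subset_ball (half_lt_self hr) h) hx
    filter_upwards [notMem_tsupport_iff_eventuallyEq.1 this] with y hy
    simp [hw, hy]
  have h1 : ∀ x, u x * trilap (stdVec (k + 6)) ψ x = w x * trilap (stdVec (k + 6)) ψ x :=
    fun x => by
      by_cases hx : x ∈ tsupport ψ
      · rw [(hwu x hx).eq_of_nhds]
      · rw [image_eq_zero_of_notMem_tsupport fun h => hx (tsupport_trilap_subset _ _ h)]
        simp
  have h2 : ∀ x, trilap (stdVec (k + 6)) w x * ψ x = -c * (u x ^ p * ψ x) := fun x => by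
    by_cases hx : x ∈ tsupport ψ
    · rw [((hwu x hx).trilap _).eq_of_nhds, hu.eq x (by rintro rfl; exact h0 hx)]
      ring
    · rw [image_eq_zero_of_notMem_tsupport hx]
      simp
  simp_rw [h1]
  rw [integral_mul_trilap hwC hψ hc]
  simp_rw [h2]
  rw [integral_const_mul, neg_mul]

lemma exists_lap_pow_mul {V ι : Type*} [NormedAddCommGroup V] [NormedSpace ℝ V] [Fintype ι]
    {φ F : V → ℝ} (hφ : ContDiff ℝ ∞ φ) (hF : ContDiff ℝ ∞ F) (v : ι → V) (m : ℕ) :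
    ∃ G : V → ℝ, ContDiff ℝ ∞ G ∧
      lap v (fun y => φ y ^ (m + 2) * F y) = fun y => φ y ^ m * G y := by
  have hne : (∞ : WithTop ℕ∞) ≠ 0 := by simp
  have hd : ∀ {h : V → ℝ}, ContDiff ℝ ∞ h → ∀ w, ContDiff ℝ ∞ fun x => fderiv ℝ h x w :=
    fun hh w => (hh.fderiv_right (by simp)).clm_apply contDiff_const
  have key : ∀ (m : ℕ) (F : V → ℝ), ContDiff ℝ ∞ F → ∀ w, ∃ G : V → ℝ, ContDiff ℝ ∞ G ∧
      (fun y => fderiv ℝ (fun z => φ z ^ (m + 1) * F z) y w) = fun y => φ y ^ m * G y := by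
    intro m F hF w
    refine ⟨fun y => (m + 1) * fderiv ℝ φ y w * F y + φ y * fderiv ℝ F y w,
      ((contDiff_const.mul (hd hφ w)).mul hF).add (hφ.mul (hd hF w)), ?_⟩
    ext y
    have h1 := (hφ.differentiable hne y).hasFDerivAt
    have h2 := (hF.differentiable hne y).hasFDerivAt
    have h3 : HasFDerivAt (fun z => φ z ^ (m + 1)) _ y := h1.pow (m + 1)
    rw [(h3.fun_mul h2).fderiv]
    simp
    ring
  choose G1 hG1 hG1' using fun i => key (m + 1) F hF (v i)
  choose G2 hG2 hG2' using fun i => key m (G1 i) (hG1 i) (v i)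
  refine ⟨fun y => ∑ i, G2 i y, ContDiff.sum fun i _ => hG2 i, ?_⟩
  ext y
  simp only [lap, Finset.mul_sum]
  refine Finset.sum_congr rfl fun i _ => ?_
  rw [hG1' i]
  exact congrFun (hG2' i) y

lemma exists_trilap_pow_bound {V ι : Type*} [NormedAddCommGroup V] [NormedSpace ℝ V] [Fintype ι]
    {φ : V → ℝ} (hφ : ContDiff ℝ ∞ φ) (hc : HasCompactSupport φ) (h0 : ∀ y, 0 ≤ φ y) (v : ι → V)
    (hk : k ≠ 0) : ∃ C, 0 < C ∧ ∀ y, |trilap v (fun y => φ y ^ (k + 6)) y| ≤ C * φ y ^ k := by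
  obtain ⟨G1, h1, e1⟩ := exists_lap_pow_mul hφ (F := fun _ => 1) contDiff_const v (k + 4)
  obtain ⟨G2, h2, e2⟩ := exists_lap_pow_mul hφ h1 v (k + 2)
  obtain ⟨G3, h3, e3⟩ := exists_lap_pow_mul hφ h2 v k
  simp only [mul_one] at e1
  obtain ⟨C, hC⟩ := hc.exists_bound_of_continuousOn h3.continuous.continuousOn
  refine ⟨max C 1, by positivity, fun y => ?_⟩
  unfold trilap
  rw [e1, e2, e3]
  simp only [abs_mul, abs_of_nonneg (pow_nonneg (h0 y) k)]
  rw [mul_comm]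
  by_cases hy : y ∈ tsupport φ
  · have := (hC y hy).trans (le_max_left C 1)
    have := pow_nonneg (h0 y) k
    gcongr
    assumption
  · simp [image_eq_zero_of_notMem_tsupport hy, hk]

lemma exists_mul_le_rpow_add {c p : ℝ} (hc : 0 < c) (hp : 1 < p) (C : ℝ) :
    ∃ C', 0 < C' ∧ ∀ t, 0 ≤ t → C * t ≤ c * t ^ p + C' := by
  obtain ⟨T, hT, hT1⟩ : ∃ T, C ≤ c * T ^ (p - 1) ∧ 1 ≤ T := by
    have := (tendsto_rpow_atTop (sub_pos.2 hp)).const_mul_atTop hc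
    exact ((this.eventually_ge_atTop C).and (eventually_ge_atTop 1)).exists
  refine ⟨|C| * T + 1, by positivity, fun t ht => ?_⟩
  rcases le_total T t with h | h
  · have htp : 0 < t := by linarith
    have h1 : t ^ p = t ^ (p - 1) * t := by
      rw [← rpow_add_one htp.ne']
      congr 1
      ring
    have h2 : T ^ (p - 1) ≤ t ^ (p - 1) := rpow_le_rpow (by linarith) h (by linarith)
    have : C * t ≤ c * t ^ (p - 1) * t := by
      gcongr
      exact hT.trans (by gcongr)
    have : 0 ≤ |C| * T := by positivity
    rw [h1]
    linarith
  · have h1 : C * t ≤ |C| * T :=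
      (mul_le_mul_of_nonneg_right (le_abs_self C) ht).trans (by gcongr)
    have : 0 ≤ c * t ^ p := by positivity
    linarith

lemma pow_rpow_eq (hp : p * k = k + 12) {s : ℝ} (hs : 0 ≤ s) : (s ^ k) ^ p = s ^ (k + 12) := by
  rw [← rpow_natCast, ← rpow_mul hs, mul_comm, hp, ← rpow_natCast]
  push_cast
  rfl

end WeakFormulation

section Growth

open scoped ContDiff

variable {k : ℕ} {p c : ℝ} {u : EuclideanSpace ℝ (Fin (k + 6)) → ℝ}

/-- The half-open spherical shell with squared radii parametrized by their square root. -/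
def shell (E : Type*) [NormedAddCommGroup E] (s : ℝ) : Set E := ball 0 (4 * s ^ 2) \ ball 0 (s ^ 2)

lemma mem_shell {E : Type*} [NormedAddCommGroup E] {s : ℝ} {y : E} :
    y ∈ shell E s ↔ s ^ 2 ≤ ‖y‖ ∧ ‖y‖ < 4 * s ^ 2 := by
  simp [shell, and_comm]

lemma measurableSet_shell {E : Type*} [NormedAddCommGroup E] [MeasurableSpace E] [BorelSpace E]
    (s : ℝ) : MeasurableSet (shell E s) := measurableSet_ball.diff measurableSet_ball

/-- A smooth cutoff function of the unit shell. -/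
lemma exists_shell_cutoff (E : Type*) [NormedAddCommGroup E] [InnerProductSpace ℝ E]
    [FiniteDimensional ℝ E] : ∃ φ : E → ℝ, ContDiff ℝ ∞ φ ∧ HasCompactSupport φ ∧
      0 ∉ tsupport φ ∧ (∀ y, 0 ≤ φ y) ∧ (∀ y, φ y ≤ 1) ∧
      (∀ y, 1 ≤ ‖y‖ → ‖y‖ ≤ 4 → φ y = 1) ∧ ∀ y, 6 ≤ ‖y‖ → φ y = 0 := by
  let χ : ContDiffBump (0 : E) := ⟨5, 6, by norm_num, by norm_num⟩
  let η : ContDiffBump (0 : E) := ⟨1 / 3, 1 / 2, by norm_num, by norm_num⟩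
  refine ⟨fun y => χ y * (1 - η y), χ.contDiff.mul (contDiff_const.sub η.contDiff),
    χ.hasCompactSupport.mul_right, ?_, fun y => mul_nonneg χ.nonneg (sub_nonneg.2 η.le_one),
    fun y => ?_, fun y h1 h4 => ?_, fun y h6 => ?_⟩
  · rw [notMem_tsupport_iff_eventuallyEq]
    filter_upwards [η.eventuallyEq_one] with y hy
    simp [hy]
  · exact mul_le_one₀ χ.le_one (sub_nonneg.2 η.le_one) (sub_le_self _ η.nonneg)
  · have e1 : χ y = 1 := χ.one_of_mem_closedBall
      (mem_closedBall_zero_iff.2 (h4.trans (show (4 : ℝ) ≤ 5 by norm_num)))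
    have e2 : η y = 0 := η.zero_of_le_dist
      ((show (1 / 2 : ℝ) ≤ 1 by norm_num).trans (h1.trans (dist_zero_right y).ge))
    simp [e1, e2]
  · have e1 : χ y = 0 := χ.zero_of_le_dist ((show (6 : ℝ) ≤ ‖y‖ from h6).trans
      (dist_zero_right y).ge)
    simp [e1]

lemma one_lt_of_mul_eq (hk : k ≠ 0) (hp : p * k = k + 12) : 1 < p := by
  have hk' : (0 : ℝ) < k := by positivity
  by_contra! h
  nlinarith

lemma IsPuncturedSolution.exists_shell_bound (hu : IsPuncturedSolution k p c u) (hk : k ≠ 0)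
    (hp : p * k = k + 12) (hc : 0 < c) : ∃ C, ∀ s, 0 < s →
      IntegrableOn (fun x => u x ^ p) (shell _ s) ∧
      ∫ x in shell _ s, u x ^ p ≤ C * s ^ k := by
  obtain ⟨φ, hφ, hφc, hφ0, hφnn, hφle, hφone, hφout⟩ :=
    exists_shell_cutoff (EuclideanSpace ℝ (Fin (k + 6)))
  obtain ⟨C, hC, hCb⟩ := exists_trilap_pow_bound hφ hφc hφnn (stdVec (k + 6)) hk
  obtain ⟨C', hC', hyoung⟩ := exists_mul_le_rpow_add (half_pos hc) (one_lt_of_mul_eq hk hp) C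
  set β := 6 ^ (k + 6) * volume.real (closedBall (0 : EuclideanSpace ℝ (Fin (k + 6))) 1) with hβ
  refine ⟨2 / c * (C' * β), fun s hs => ?_⟩
  have hs2 : 0 < s ^ 2 := by positivity
  set N : EuclideanSpace ℝ (Fin (k + 6)) → ℝ := fun y => φ ((s ^ 2)⁻¹ • y) with hN
  have hN0 : 0 ∉ tsupport N := by
    rw [notMem_tsupport_iff_eventuallyEq] at hφ0 ⊢
    have : Tendsto (fun y : EuclideanSpace ℝ (Fin (k + 6)) => (s ^ 2)⁻¹ • y) (𝓝 0) (𝓝 0) := by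
      simpa using (continuous_const_smul ((s ^ 2)⁻¹)).tendsto
        (0 : EuclideanSpace ℝ (Fin (k + 6)))
    exact this.eventually hφ0
  have hNc : HasCompactSupport N := hφc.comp_smul (inv_ne_zero hs2.ne')
  have hNC : ContDiff ℝ ∞ N := hφ.comp (contDiff_const_smul _)
  set ψ : EuclideanSpace ℝ (Fin (k + 6)) → ℝ := fun y => N y ^ (k + 6) with hψ
  have hψsub : tsupport ψ ⊆ tsupport N := closure_mono fun y hy h => hy (by simp [hψ, h])
  have hψ0 : 0 ∉ tsupport ψ := fun h => hN0 (hψsub h)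
  have hψc : HasCompactSupport ψ := hNc.of_isClosed_subset isClosed_closure hψsub
  have hψC : ContDiff ℝ 6 ψ := (hNC.pow (k + 6)).of_le (WithTop.coe_le_coe.2 (le_top : (6 : ℕ∞) ≤ ⊤))
  have hT : ∀ y, |trilap (stdVec (k + 6)) ψ y| ≤ (s ^ 12)⁻¹ * (C * N y ^ k) := fun y => by
    have : ψ = fun y => (fun z => φ z ^ (k + 6)) ((s ^ 2)⁻¹ • y) := rfl
    rw [this, trilap_comp_smul _ (fun z => φ z ^ (k + 6)), abs_mul, abs_of_nonneg (by positivity),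
      inv_pow, ← pow_mul]
    gcongr
    exact hCb _
  have hTcont : Continuous (trilap (stdVec (k + 6)) ψ) :=
    (hψC.trilap (m := 0) (by norm_num) _).continuous
  have hI1 : Integrable fun x => u x ^ p * ψ x :=
    integrable_mul_of_zero_notMem_tsupport hu.continuousOn_rpow hψC.continuous hψc hψ0
  have hI2 : Integrable fun x => u x * trilap (stdVec (k + 6)) ψ x :=
    integrable_mul_of_zero_notMem_tsupport hu.continuousOn hTcont (hψc.trilap _)
      fun h => hψ0 (tsupport_trilap_subset _ _ h)
  set B := closedBall (0 : EuclideanSpace ℝ (Fin (k + 6))) (s ^ 2 * 6)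
  have hI3 : Integrable (B.indicator fun _ => C' * (s ^ (k + 12))⁻¹) :=
    (integrable_indicator_iff measurableSet_closedBall).2
      (integrableOn_const measure_closedBall_lt_top.ne)
  have hpt : ∀ x, -(u x * trilap (stdVec (k + 6)) ψ x) ≤
      c / 2 * (u x ^ p * ψ x) + B.indicator (fun _ => C' * (s ^ (k + 12))⁻¹) x := fun x => by
    have hBnn : 0 ≤ B.indicator (fun _ => C' * (s ^ (k + 12))⁻¹) x :=
      indicator_nonneg (fun _ _ => by positivity) x
    by_cases hNx : N x = 0
    · have h0 : trilap (stdVec (k + 6)) ψ x = 0 := by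
        have := hT x
        rw [hNx, zero_pow hk, mul_zero, mul_zero] at this
        exact abs_nonpos_iff.1 this
      simpa only [h0, mul_zero, neg_zero, show ψ x = 0 by simp [hψ, hNx], zero_add] using hBnn
    · have hx : x ≠ 0 := by
        rintro rfl
        exact hNx (image_eq_zero_of_notMem_tsupport hN0)
      have hxB : x ∈ B := by
        by_contra h
        refine hNx (hφout _ ?_)
        have : s ^ 2 * 6 < ‖x‖ := by simpa [B] using h
        rw [norm_smul, norm_of_nonneg (by positivity), inv_mul_eq_div, le_div_iff₀ hs2]
        linarith
      have hux := hu.pos x hx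
      have hNnn : 0 ≤ N x := hφnn _
      have hNle : N x ≤ 1 := hφle _
      rw [indicator_of_mem hxB]
      have h1 := hyoung (s ^ k * u x * N x ^ k) (by positivity)
      rw [mul_rpow (by positivity) (by positivity), mul_rpow (by positivity) hux.le,
        pow_rpow_eq hp hs.le, pow_rpow_eq hp hNnn] at h1
      have h2 : N x ^ (k + 12) ≤ N x ^ (k + 6) := pow_le_pow_of_le_one hNnn hNle (by omega)
      have hup := rpow_pos_of_pos hux p
      calc -(u x * trilap (stdVec (k + 6)) ψ x)
          ≤ u x * |trilap (stdVec (k + 6)) ψ x| := by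
            rw [← mul_neg]
            gcongr
            exact neg_le_abs _
        _ ≤ u x * ((s ^ 12)⁻¹ * (C * N x ^ k)) := by
            gcongr
            exact hT x
        _ = (s ^ (k + 12))⁻¹ * (C * (s ^ k * u x * N x ^ k)) := by
            rw [pow_add]
            field_simp
        _ ≤ (s ^ (k + 12))⁻¹ * (c / 2 * (s ^ (k + 12) * u x ^ p * N x ^ (k + 12)) + C') := by
            gcongr
        _ ≤ (s ^ (k + 12))⁻¹ * (c / 2 * (s ^ (k + 12) * u x ^ p * N x ^ (k + 6)) + C') := by
            gcongr
        _ = _ := by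
            simp only [hψ]
            field_simp
  have hmono := integral_mono hI2.neg ((hI1.const_mul (c / 2)).add hI3) hpt
  have hweak := hu.integral_mul_trilap_of_notMem hψC hψc hψ0
  simp only [Pi.neg_apply] at hmono
  rw [integral_neg, hweak, neg_neg] at hmono
  simp only [Pi.add_apply] at hmono
  rw [integral_add (hI1.const_mul _) hI3, integral_const_mul,
    integral_indicator measurableSet_closedBall, setIntegral_const,
    Measure.addHaar_real_closedBall' volume _ (by positivity), finrank_euclideanSpace,
    Fintype.card_fin, smul_eq_mul, mul_pow _ (6 : ℝ), mul_assoc _ (6 ^ (k + 6) : ℝ), ← hβ] at hmono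
  have hle : ∫ x, u x ^ p * ψ x ≤ 2 / c * (C' * β) * s ^ k := by
    have e : (s ^ 2) ^ (k + 6) = s ^ (k + 12) * s ^ k := by ring
    have e2 : (s ^ 2) ^ (k + 6) * β * (C' * (s ^ (k + 12))⁻¹) = C' * β * s ^ k := by
      rw [e]
      field_simp
    rw [e2] at hmono
    rw [div_mul_eq_mul_div, div_mul_eq_mul_div, le_div_iff₀ hc]
    linarith
  have hψone : ∀ x ∈ shell _ s, ψ x = 1 := fun x hx => by
    rw [mem_shell] at hx
    simp only [hψ, hN]
    rw [hφone, one_pow]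
    · rw [norm_smul, norm_of_nonneg (by positivity), inv_mul_eq_div, le_div_iff₀ hs2]
      linarith
    · rw [norm_smul, norm_of_nonneg (by positivity), inv_mul_eq_div, div_le_iff₀ hs2]
      linarith
  have hcongr : EqOn (fun x => u x ^ p * ψ x) (fun x => u x ^ p) (shell _ s) := fun x hx => by
    simp [hψone x hx]
  refine ⟨hI1.integrableOn.congr_fun hcongr (measurableSet_shell s), ?_⟩
  rw [← setIntegral_congr_fun (measurableSet_shell s) hcongr]
  refine (setIntegral_le_integral hI1 (Eventually.of_forall fun x => ?_)).trans hle
  by_cases hx : x = 0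
  · simp [hx, image_eq_zero_of_notMem_tsupport hψ0]
  · exact mul_nonneg (rpow_nonneg (hu.pos x hx).le p) (pow_nonneg (hφnn _) _)

lemma IsPuncturedSolution.exists_shell_bound_self (hu : IsPuncturedSolution k p c u) (hk : k ≠ 0)
    (hp : p * k = k + 12) (hc : 0 < c) : ∃ C, ∀ s, 0 < s →
      IntegrableOn u (shell _ s) ∧ ∫ x in shell _ s, u x ≤ C * s ^ (k + 12) := by
  obtain ⟨C, hC⟩ := hu.exists_shell_bound hk hp hc
  set β := 4 ^ (k + 6) * volume.real (closedBall (0 : EuclideanSpace ℝ (Fin (k + 6))) 1) with hβ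
  refine ⟨β + C, fun s hs => ?_⟩
  obtain ⟨hi, hle⟩ := hC s hs
  have hfin : volume (shell (EuclideanSpace ℝ (Fin (k + 6))) s) ≠ ⊤ :=
    ((measure_mono sdiff_subset).trans_lt measure_ball_lt_top).ne
  have hne : ∀ x ∈ shell (EuclideanSpace ℝ (Fin (k + 6))) s, x ≠ 0 := fun x hx => by
    rintro rfl
    rw [mem_shell, norm_zero] at hx
    nlinarith
  have hpt : ∀ x ∈ shell (EuclideanSpace ℝ (Fin (k + 6))) s,
      u x ≤ (s ^ k)⁻¹ + s ^ 12 * u x ^ p := fun x hx => by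
    have hux := hu.pos x (hne x hx)
    have h1 : s ^ k * u x ≤ 1 + (s ^ k * u x) ^ p := by
      rcases le_total (s ^ k * u x) 1 with h | h
      · have : 0 ≤ (s ^ k * u x) ^ p := by positivity
        linarith
      · linarith [self_le_rpow_of_one_le h (one_lt_of_mul_eq hk hp).le]
    rw [mul_rpow (by positivity) hux.le, pow_rpow_eq hp hs.le] at h1
    have h2 := mul_le_mul_of_nonneg_left h1 (show 0 ≤ (s ^ k)⁻¹ by positivity)
    have e1 : (s ^ k)⁻¹ * (s ^ k * u x) = u x := by field_simp
    have e2 : (s ^ k)⁻¹ * (1 + s ^ (k + 12) * u x ^ p) = (s ^ k)⁻¹ + s ^ 12 * u x ^ p := by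
      rw [pow_add]
      field_simp
    rwa [e1, e2] at h2
  have hg : IntegrableOn (fun x => (s ^ k)⁻¹ + s ^ 12 * u x ^ p) (shell _ s) :=
    (integrableOn_const hfin).add (hi.const_mul _)
  have hi' : IntegrableOn u (shell _ s) := by
    refine hg.mono' ((hu.continuousOn.mono hne).aestronglyMeasurable (measurableSet_shell s)) ?_
    filter_upwards [ae_restrict_mem (measurableSet_shell s)] with x hx
    rw [norm_of_nonneg (hu.pos x (hne x hx)).le]
    exact hpt x hx
  refine ⟨hi', (setIntegral_mono_on hi' hg (measurableSet_shell s) hpt).trans ?_⟩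
  have hvol : volume.real (shell (EuclideanSpace ℝ (Fin (k + 6))) s) ≤ (s ^ 2) ^ (k + 6) * β := by
    have := Measure.addHaar_real_closedBall' volume (0 : EuclideanSpace ℝ (Fin (k + 6)))
      (r := 4 * s ^ 2) (by positivity)
    rw [finrank_euclideanSpace, Fintype.card_fin, mul_comm 4, mul_pow _ (4 : ℝ), mul_assoc,
      ← hβ] at this
    rw [← this, mul_comm (s ^ 2)]
    exact measureReal_mono (sdiff_subset.trans ball_subset_closedBall) measure_closedBall_lt_top.ne
  have hcst : Integrable (fun _ => (s ^ k)⁻¹)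
      (volume.restrict (shell (EuclideanSpace ℝ (Fin (k + 6))) s)) := integrableOn_const hfin
  rw [integral_add hcst (hi.const_mul _), setIntegral_const, integral_const_mul, smul_eq_mul]
  calc _ ≤ (s ^ 2) ^ (k + 6) * β * (s ^ k)⁻¹ + s ^ 12 * (C * s ^ k) := by gcongr
    _ = _ := by
      rw [show (s ^ 2) ^ (k + 6) = s ^ (k + 12) * s ^ k by ring]
      field_simp
      ring

end Growth

section Dyadic

variable {E : Type*} [NormedAddCommGroup E]

lemma pairwise_disjoint_shell (s : ℝ) :
    Pairwise (Function.onFun Disjoint fun i : ℕ => shell E (s / 2 ^ i)) := by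
  have key : ∀ {i j : ℕ}, i < j → Disjoint (shell E (s / 2 ^ i)) (shell E (s / 2 ^ j)) :=
    fun {i j} hij => disjoint_left.2 fun x hi hj => by
      rw [mem_shell] at hi hj
      have h1 : 4 * (s / 2 ^ j) ^ 2 ≤ (s / 2 ^ i) ^ 2 := by
        obtain ⟨m, rfl⟩ := Nat.exists_eq_add_of_lt hij
        have e : 4 * (s / 2 ^ (i + m + 1)) ^ 2 = (s / 2 ^ i) ^ 2 * ((2 ^ m) ^ 2)⁻¹ := by
          field_simp
          ring
        rw [e]
        exact mul_le_of_le_one_right (by positivity)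
          (inv_le_one_of_one_le₀ (one_le_pow₀ (one_le_pow₀ (by norm_num))))
      linarith [hi.1, hj.2]
  intro i j hij
  rcases lt_or_gt_of_ne hij with h | h
  · exact key h
  · exact (key h).symm

lemma iUnion_shell_eq {s : ℝ} (hs : 0 < s) :
    ⋃ i : ℕ, shell E (s / 2 ^ i) = ball 0 (4 * s ^ 2) \ {0} := by
  ext x
  simp only [mem_iUnion, mem_shell, Set.mem_sdiff, mem_ball_zero_iff, mem_singleton_iff]
  constructor
  · rintro ⟨i, h1, h2⟩
    have hpos : 0 < (s / 2 ^ i) ^ 2 := by positivity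
    refine ⟨h2.trans_le ?_, norm_pos_iff.1 (hpos.trans_le h1)⟩
    gcongr
    exact div_le_self hs.le (one_le_pow₀ (by norm_num))
  · rintro ⟨h1, h2⟩
    have hx : 0 < ‖x‖ := norm_pos_iff.2 h2
    have hlim : ∃ i : ℕ, (s / 2 ^ i) ^ 2 ≤ ‖x‖ := by
      obtain ⟨i, hi⟩ := exists_pow_lt_of_lt_one (show 0 < ‖x‖ / s ^ 2 by positivity)
        (show (1 / 4 : ℝ) < 1 by norm_num)
      refine ⟨i, ?_⟩
      rw [lt_div_iff₀ (by positivity)] at hi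
      have e : (s / 2 ^ i) ^ 2 = (1 / 4) ^ i * s ^ 2 := by
        rw [div_pow, ← pow_mul, mul_comm i, pow_mul, one_div, inv_pow]
        norm_num
        field_simp
      rw [e]
      exact hi.le
    classical
    refine ⟨Nat.find hlim, Nat.find_spec hlim, ?_⟩
    rcases h : Nat.find hlim with _ | j
    · simpa using h1
    · have := Nat.find_min hlim (m := j) (by omega)
      rw [not_le] at this
      refine this.trans_eq ?_
      field_simp
      ring

variable [MeasurableSpace E] [BorelSpace E] {μ : Measure E} {f : E → ℝ} {C : ℝ} {a b : ℕ}

lemma ball_bound_of_shell_bound [NullSingletonClass μ] (ha : a ≠ 0) (hf0 : ∀ x ≠ 0, 0 ≤ f x)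
    (hf : ∀ s, 0 < s → IntegrableOn f (shell E s) μ ∧ ∫ x in shell E s, f x ∂μ ≤ C * s ^ a)
    {s : ℝ} (hs : 0 < s) :
    IntegrableOn f (ball 0 (4 * s ^ 2)) μ ∧ ∫ x in ball 0 (4 * s ^ 2), f x ∂μ ≤ 2 * C * s ^ a := by
  have hC : 0 ≤ C := by
    have h1 := (hf 1 one_pos).2
    have h2 : 0 ≤ ∫ x in shell E 1, f x ∂μ := setIntegral_nonneg (measurableSet_shell 1)
      fun x hx => hf0 x (by rintro rfl; rw [mem_shell, norm_zero] at hx; linarith [hx.1])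
    simpa using h2.trans h1
  have hae : (ball (0 : E) (4 * s ^ 2) \ {0} : Set E) =ᵐ[μ] ball 0 (4 * s ^ 2) :=
    sdiff_null_ae_eq_self (measure_singleton 0)
  have hsi : ∀ i : ℕ, 0 < s / 2 ^ i := fun i => by positivity
  have hpos : ∀ i : ℕ, ∀ x ∈ shell E (s / 2 ^ i), 0 ≤ f x := fun i x hx => hf0 x (by
    rintro rfl
    rw [mem_shell, norm_zero] at hx
    have := pow_pos (hsi i) 2
    linarith [hx.1])
  have hle : ∀ i : ℕ, ∫ x in shell E (s / 2 ^ i), f x ∂μ ≤ C * s ^ a * (1 / 2) ^ i := fun i => by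
    refine ((hf _ (hsi i)).2).trans ?_
    rw [mul_assoc]
    gcongr
    rw [div_pow, one_div, inv_pow, div_eq_mul_inv]
    gcongr
    exact le_self_pow₀ (one_le_pow₀ (by norm_num)) ha
  have hsum : Summable fun i : ℕ => C * s ^ a * (1 / 2 : ℝ) ^ i :=
    summable_geometric_two.mul_left _
  have hint : IntegrableOn f (⋃ i : ℕ, shell E (s / 2 ^ i)) μ := by
    refine integrableOn_iUnion_of_summable_integral_norm
      (fun i => (hf _ (hsi i)).1) ?_
    refine hsum.of_nonneg_of_le (fun i => by positivity) fun i => ?_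
    rw [setIntegral_congr_fun (measurableSet_shell _)
      (fun x hx => norm_of_nonneg (hpos i x hx) : EqOn _ f _)]
    exact hle i
  have hhas := hasSum_integral_iUnion (fun i : ℕ => measurableSet_shell (E := E) (s / 2 ^ i))
    (pairwise_disjoint_shell s) hint
  have hfin := hasSum_le hle hhas (summable_geometric_two.hasSum.mul_left _)
  rw [iUnion_shell_eq hs] at hint hfin
  rw [setIntegral_congr_set hae, tsum_geometric_two] at hfin
  exact ⟨hint.congr_set_ae hae.symm, by linarith⟩

lemma integrableOn_mul_inv_pow_of_shell_bound (hab : a + 1 ≤ 2 * b) (hf0 : ∀ x ≠ 0, 0 ≤ f x)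
    (hf : ∀ s, 0 < s → IntegrableOn f (shell E s) μ ∧ ∫ x in shell E s, f x ∂μ ≤ C * s ^ a) :
    IntegrableOn (fun x => f x * (‖x‖ ^ b)⁻¹) (ball 0 1)ᶜ μ := by
  have hC : 0 ≤ C := by
    have h1 := (hf 1 one_pos).2
    have h2 : 0 ≤ ∫ x in shell E 1, f x ∂μ := setIntegral_nonneg (measurableSet_shell 1)
      fun x hx => hf0 x (by rintro rfl; rw [mem_shell, norm_zero] at hx; linarith [hx.1])
    simpa using h2.trans h1
  have hsub : (ball (0 : E) 1)ᶜ ⊆ ⋃ i : ℕ, shell E (2 ^ i) := fun x hx => by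
    have hx1 : 1 ≤ ‖x‖ := by simpa using hx
    have hlim : ∃ i : ℕ, ‖x‖ < 4 * (2 ^ i) ^ 2 := by
      obtain ⟨i, hi⟩ := pow_unbounded_of_one_lt ‖x‖ (show (1 : ℝ) < 2 by norm_num)
      refine ⟨i, hi.trans_le ?_⟩
      have : (1 : ℝ) ≤ 2 ^ i := one_le_pow₀ (by norm_num)
      nlinarith
    classical
    simp only [mem_iUnion, mem_shell]
    refine ⟨Nat.find hlim, ?_, Nat.find_spec hlim⟩
    rcases h : Nat.find hlim with _ | j
    · simpa using hx1
    · have := Nat.find_min hlim (m := j) (by omega)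
      rw [not_lt] at this
      refine le_trans (le_of_eq ?_) this
      ring
  refine IntegrableOn.mono_set ?_ hsub
  have hpos : ∀ i : ℕ, ∀ x ∈ shell E (2 ^ i), 0 ≤ f x ∧ (‖x‖ ^ b)⁻¹ ≤ ((2 ^ i) ^ (2 * b))⁻¹ :=
    fun i x hx => by
      rw [mem_shell] at hx
      have h2 : (0 : ℝ) < (2 ^ i) ^ 2 := by positivity
      refine ⟨hf0 x (norm_pos_iff.1 (h2.trans_le hx.1)), ?_⟩
      rw [pow_mul]
      gcongr
      exact hx.1
  have hmeas : ∀ i : ℕ, AEStronglyMeasurable (fun x : E => (‖x‖ ^ b)⁻¹)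
      (μ.restrict (shell E (2 ^ i))) := fun i => by
    have : Measurable fun x : E => (‖x‖ ^ b)⁻¹ := (measurable_norm.pow_const b).inv
    exact this.aestronglyMeasurable
  have hi : ∀ i : ℕ, IntegrableOn (fun x => f x * (‖x‖ ^ b)⁻¹) (shell E (2 ^ i)) μ := fun i => by
    refine (hf _ (by positivity)).1.mul_bdd (c := ((2 ^ i) ^ (2 * b))⁻¹) (hmeas i) ?_
    filter_upwards [ae_restrict_mem (measurableSet_shell _)] with x hx
    rw [norm_of_nonneg (by positivity)]
    exact (hpos i x hx).2
  refine integrableOn_iUnion_of_summable_integral_norm hi ?_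
  refine (summable_geometric_two.mul_left C).of_nonneg_of_le (fun i => by positivity) fun i => ?_
  have h1 : ∫ x in shell E (2 ^ i), ‖f x * (‖x‖ ^ b)⁻¹‖ ∂μ ≤
      ∫ x in shell E (2 ^ i), f x * ((2 ^ i) ^ (2 * b))⁻¹ ∂μ := by
    refine setIntegral_mono_on (hi i).norm ((hf _ (by positivity)).1.mul_const _)
      (measurableSet_shell _) fun x hx => ?_
    have := hpos i x hx
    rw [norm_of_nonneg (mul_nonneg this.1 (by positivity))]
    exact mul_le_mul_of_nonneg_left this.2 this.1
  refine h1.trans ?_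
  rw [integral_mul_const]
  calc _ ≤ C * (2 ^ i) ^ a * ((2 ^ i) ^ (2 * b))⁻¹ := by
        gcongr
        exact (hf _ (by positivity)).2
    _ ≤ C * (1 / 2) ^ i := by
        rw [mul_assoc, one_div, inv_pow]
        gcongr
        rw [← div_eq_mul_inv, div_le_iff₀ (by positivity), inv_mul_eq_div, le_div_iff₀ (by positivity),
          ← pow_succ]
        exact pow_le_pow_right₀ (one_le_pow₀ (by norm_num)) hab

end Dyadic

section Extension

open scoped ContDiff

variable {k : ℕ} {p c : ℝ} {u ψ : EuclideanSpace ℝ (Fin (k + 6)) → ℝ}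

lemma ae_ne_zero (k : ℕ) : ∀ᵐ x : EuclideanSpace ℝ (Fin (k + 6)), x ≠ 0 :=
  compl_mem_ae_iff.2 (measure_singleton 0)

lemma locallyIntegrable_of_integrableOn_ball {E : Type*} [NormedAddCommGroup E]
    [MeasurableSpace E] {μ : Measure E} {f : E → ℝ}
    (hf : ∀ s : ℝ, 0 < s → IntegrableOn f (ball 0 (4 * s ^ 2)) μ) : LocallyIntegrable f μ :=
  fun x => by
    have h1 : 0 < 1 + ‖x‖ := by positivity
    refine ⟨ball 0 (4 * (1 + ‖x‖) ^ 2), isOpen_ball.mem_nhds ?_, hf _ h1⟩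
    rw [mem_ball_zero_iff]
    nlinarith [norm_nonneg x]

lemma IsPuncturedSolution.rpow_nonneg (hu : IsPuncturedSolution k p c u) :
    ∀ x ≠ 0, 0 ≤ u x ^ p := fun x hx => Real.rpow_nonneg (hu.pos x hx).le p

lemma IsPuncturedSolution.locallyIntegrable (hu : IsPuncturedSolution k p c u) (hk : k ≠ 0)
    (hp : p * k = k + 12) (hc : 0 < c) : LocallyIntegrable u := by
  obtain ⟨C, hC⟩ := hu.exists_shell_bound_self hk hp hc
  exact locallyIntegrable_of_integrableOn_ball fun s hs =>
    (ball_bound_of_shell_bound (by omega) (fun x hx => (hu.pos x hx).le) hC hs).1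

lemma IsPuncturedSolution.locallyIntegrable_rpow (hu : IsPuncturedSolution k p c u) (hk : k ≠ 0)
    (hp : p * k = k + 12) (hc : 0 < c) : LocallyIntegrable fun x => u x ^ p := by
  obtain ⟨C, hC⟩ := hu.exists_shell_bound hk hp hc
  exact locallyIntegrable_of_integrableOn_ball fun s hs =>
    (ball_bound_of_shell_bound hk hu.rpow_nonneg hC hs).1

/-- The origin is a removable singularity for the distributional equation. -/
lemma IsPuncturedSolution.integral_mul_trilap (hu : IsPuncturedSolution k p c u) (hk : k ≠ 0)
    (hp : p * k = k + 12) (hc : 0 < c) (hψ : ContDiff ℝ ∞ ψ) (hψc : HasCompactSupport ψ) :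
    ∫ x, u x * trilap (stdVec (k + 6)) ψ x = -(c * ∫ x, u x ^ p * ψ x) := by
  obtain ⟨C, hC⟩ := hu.exists_shell_bound_self hk hp hc
  have hball := fun {s : ℝ} (hs : 0 < s) => ball_bound_of_shell_bound (by omega)
    (fun x hx => (hu.pos x hx).le) hC hs
  set T := trilap (stdVec (k + 6)) with hT
  have hTcont : ∀ {φ : EuclideanSpace ℝ (Fin (k + 6)) → ℝ}, ContDiff ℝ ∞ φ → Continuous (T φ) :=
    fun {φ} hφ => ContDiff.continuous (𝕜 := ℝ) (n := 0)
      ((hφ.of_le (WithTop.coe_le_coe.2 (le_top : (6 : ℕ∞) ≤ ⊤))).trilap (m := 0)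
        (m' := 6) (by norm_num) _)
  let η : ContDiffBump (0 : EuclideanSpace ℝ (Fin (k + 6))) := ⟨1, 2, by norm_num, by norm_num⟩
  have hη1 : ∀ {y : EuclideanSpace ℝ (Fin (k + 6))}, 2 ≤ ‖y‖ → η y = 0 := fun {y} hy =>
    η.zero_of_le_dist (by simpa [η] using hy)
  let F : ℝ × EuclideanSpace ℝ (Fin (k + 6)) → ℝ := fun q => (1 - η q.2) * ψ (q.1 • q.2)
  have hF : ContDiff ℝ ∞ F := (contDiff_const.sub (η.contDiff.comp contDiff_snd)).mul
    (hψ.comp (contDiff_fst.smul contDiff_snd))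
  obtain ⟨C₁, hC₁, hb₁⟩ := exists_trilap_slice_bound isOpen_univ hF.contDiffOn
    ((isCompact_Icc (a := (0 : ℝ)) (b := 1)).prod
      (isCompact_closedBall (0 : EuclideanSpace ℝ (Fin (k + 6))) 4)) (subset_univ _)
    (stdVec (k + 6))
  obtain ⟨C₂, hC₂⟩ := (hψc.trilap (stdVec (k + 6))).exists_bound_of_continuous (hTcont hψ)
  have hC₂0 : 0 ≤ C₂ := (norm_nonneg _).trans (hC₂ 0)
  set s : ℕ → ℝ := fun m => 1 / ((m : ℝ) + 1) with hs
  have hs0 : ∀ m, 0 < s m := fun m => by positivity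
  have hs1 : ∀ m, s m ≤ 1 := fun m => by
    rw [hs]
    exact div_le_one_of_le₀ (by linarith [m.cast_nonneg (α := ℝ)]) (by positivity)
  have hslim : Tendsto s atTop (𝓝 0) := tendsto_one_div_add_atTop_nhds_zero_nat
  have hs2 : ∀ m, 0 < s m ^ 2 := fun m => pow_pos (hs0 m) 2
  set Ψ : ℕ → EuclideanSpace ℝ (Fin (k + 6)) → ℝ :=
    fun m y => (1 - η ((s m ^ 2)⁻¹ • y)) * ψ y with hΨ
  have hone : ∀ m y, 2 * s m ^ 2 ≤ ‖y‖ → Ψ m y = ψ y := fun m y hy => by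
    have : η ((s m ^ 2)⁻¹ • y) = 0 := hη1 (by
      rw [norm_smul, norm_of_nonneg (inv_nonneg.2 (hs2 m).le), inv_mul_eq_div,
        le_div_iff₀ (hs2 m)]
      exact hy)
    simp [hΨ, this]
  have hΨC : ∀ m, ContDiff ℝ ∞ (Ψ m) := fun m =>
    (contDiff_const.sub (η.contDiff.comp (contDiff_const_smul _))).mul hψ
  have hΨc : ∀ m, HasCompactSupport (Ψ m) := fun m => hψc.mul_left
  have hΨ0 : ∀ m, 0 ∉ tsupport (Ψ m) := fun m => by
    rw [notMem_tsupport_iff_eventuallyEq]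
    have : Tendsto (fun y : EuclideanSpace ℝ (Fin (k + 6)) => (s m ^ 2)⁻¹ • y) (𝓝 0) (𝓝 0) := by
      simpa using (continuous_const_smul ((s m ^ 2)⁻¹)).tendsto
        (0 : EuclideanSpace ℝ (Fin (k + 6)))
    filter_upwards [this.eventually η.eventuallyEq_one] with y hy
    simp only [hΨ, hy]
    simp
  have hweak := fun m => hu.integral_mul_trilap_of_notMem
    ((hΨC m).of_le (WithTop.coe_le_coe.2 (le_top : (6 : ℕ∞) ≤ ⊤))) (hΨc m) (hΨ0 m)
  have hloc := hu.locallyIntegrable hk hp hc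
  have hlocp := hu.locallyIntegrable_rpow hk hp hc
  have hint : ∀ {φ : EuclideanSpace ℝ (Fin (k + 6)) → ℝ}, ContDiff ℝ ∞ φ → HasCompactSupport φ →
      Integrable fun x => u x * T φ x := fun {φ} hφ hφc =>
    hloc.integrable_smul_right_of_hasCompactSupport (hTcont hφ) (hφc.trilap _)
  have hintp : Integrable fun x => u x ^ p * ψ x :=
    hlocp.integrable_smul_right_of_hasCompactSupport hψ.continuous hψc
  have hR : Tendsto (fun m => ∫ x, u x ^ p * Ψ m x) atTop (𝓝 (∫ x, u x ^ p * ψ x)) := by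
    refine tendsto_integral_of_dominated_convergence (fun x => ‖u x ^ p * ψ x‖) (fun m =>
      (hlocp.integrable_smul_right_of_hasCompactSupport (hΨC m).continuous
        (hΨc m)).aestronglyMeasurable) hintp.norm (fun m => Eventually.of_forall fun x => ?_) ?_
    · change ‖u x ^ p * Ψ m x‖ ≤ ‖u x ^ p * ψ x‖
      rw [norm_mul (u x ^ p) (ψ x), norm_mul]
      refine mul_le_mul_of_nonneg_left ?_ (norm_nonneg (u x ^ p))
      simp only [hΨ]
      rw [norm_mul, norm_of_nonneg (sub_nonneg.2 η.le_one)]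
      exact mul_le_of_le_one_left (norm_nonneg _) (sub_le_self _ η.nonneg)
    · filter_upwards [ae_ne_zero k] with x hx
      refine tendsto_const_nhds.congr' ?_
      have h2 : Tendsto (fun m => 2 * s m ^ 2) atTop (𝓝 0) := by
        simpa using (hslim.pow 2).const_mul 2
      filter_upwards [h2.eventually (eventually_lt_nhds (norm_pos_iff.2 hx))] with m hm
      rw [hone m x hm.le]
  have hpt : ∀ m, ∀ x ≠ 0, ‖u x * T (Ψ m) x - u x * T ψ x‖ ≤
      (ball 0 (4 * s m ^ 2)).indicator (fun x => (C₁ * (s m ^ 12)⁻¹ + C₂) * u x) x :=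
    fun m x hx => by
      rw [← mul_sub, norm_mul, norm_of_nonneg (hu.pos x hx).le, mul_comm]
      by_cases hxb : x ∈ ball 0 (4 * s m ^ 2)
      · rw [indicator_of_mem hxb]
        have hxn : ‖x‖ < 4 * s m ^ 2 := by simpa using hxb
        refine mul_le_mul_of_nonneg_right ((norm_sub_le _ _).trans (add_le_add ?_ (hC₂ x)))
          (hu.pos x hx).le
        have e : Ψ m = fun y => (fun z => F (s m ^ 2, z)) ((s m ^ 2)⁻¹ • y) := by
          funext y
          simp only [hΨ, F]
          rw [smul_inv_smul₀ (hs2 m).ne']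
        rw [e, hT, trilap_comp_smul _ (fun z => F (s m ^ 2, z)), norm_mul, inv_pow, ← pow_mul,
          norm_of_nonneg (by have := hs0 m; positivity), mul_comm]
        have := hs0 m
        gcongr
        refine hb₁ _ _ ⟨⟨(hs2 m).le, pow_le_one₀ (hs0 m).le (hs1 m)⟩, ?_⟩
        rw [mem_closedBall_zero_iff, norm_smul, norm_of_nonneg (by positivity), inv_mul_eq_div,
          div_le_iff₀ (hs2 m)]
        exact hxn.le
      · rw [indicator_of_notMem hxb]
        have hxn : 4 * s m ^ 2 ≤ ‖x‖ := by simpa using hxb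
        have : Ψ m =ᶠ[𝓝 x] ψ := by
          filter_upwards [continuous_norm.continuousAt.eventually (lt_mem_nhds
            (show 2 * s m ^ 2 < ‖x‖ by linarith [hs2 m]))] with y hy
          exact hone m y hy.le
        rw [hT, (this.trilap _).eq_of_nhds]
        simp
  have hL : Tendsto (fun m => ∫ x, u x * T (Ψ m) x) atTop (𝓝 (∫ x, u x * T ψ x)) := by
    rw [tendsto_iff_norm_sub_tendsto_zero]
    refine squeeze_zero (g := fun m => (C₁ + C₂) * (2 * C) * s m ^ k) (fun m => norm_nonneg _)
      (fun m => ?_) ?_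
    · rw [← integral_sub (hint (hΨC m) (hΨc m)) (hint hψ hψc)]
      refine (norm_integral_le_of_norm_le ((integrable_indicator_iff measurableSet_ball).2
        ((hball (hs0 m)).1.const_mul _)) ((ae_ne_zero k).mono (hpt m))).trans ?_
      rw [integral_indicator measurableSet_ball, integral_const_mul]
      have h12 : 0 < s m ^ 12 := pow_pos (hs0 m) 12
      have hC₂' : C₂ ≤ C₂ * (s m ^ 12)⁻¹ := le_mul_of_one_le_right hC₂0
        (one_le_inv_iff₀.2 ⟨h12, pow_le_one₀ (hs0 m).le (hs1 m)⟩)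
      have hnn : 0 ≤ ∫ x in ball 0 (4 * s m ^ 2), u x :=
        integral_nonneg_of_ae (ae_restrict_of_ae ((ae_ne_zero k).mono fun x hx =>
          (hu.pos x hx).le))
      calc _ ≤ (C₁ * (s m ^ 12)⁻¹ + C₂ * (s m ^ 12)⁻¹) * (2 * C * s m ^ (k + 12)) := by
            gcongr
            exact (hball (hs0 m)).2
        _ = _ := by
            have := (hs0 m).ne'
            rw [pow_add]
            field_simp
    · simpa [hk] using (hslim.pow k).const_mul ((C₁ + C₂) * (2 * C))
  refine tendsto_nhds_unique hL ?_
  simp_rw [hT, hweak]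
  exact (hR.const_mul c).neg

end Extension

section Bubble

open scoped ContDiff

variable {k : ℕ} {p c δ : ℝ} {u : EuclideanSpace ℝ (Fin (k + 6)) → ℝ}

lemma bubble_pos (x y : EuclideanSpace ℝ (Fin (k + 6))) (hδ : 0 < δ) :
    0 < ‖x - y‖ ^ 2 + δ ^ 2 := by positivity

lemma integrable_mul_of_decay {E : Type*} [NormedAddCommGroup E] [NormedSpace ℝ E]
    [FiniteDimensional ℝ E] [MeasurableSpace E] [BorelSpace E] {μ : Measure E} {f g : E → ℝ}
    {b : ℕ} {M : ℝ} (hf : LocallyIntegrable f μ)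
    (hfd : IntegrableOn (fun x => f x * (‖x‖ ^ b)⁻¹) (ball 0 1)ᶜ μ) (hg : Continuous g)
    (hgd : ∀ x, 1 ≤ ‖x‖ → |g x| ≤ M * (‖x‖ ^ b)⁻¹) : Integrable (fun x => f x * g x) μ := by
  have h1 : IntegrableOn (fun x => f x * g x) (ball 0 1) μ :=
    ((hf.integrableOn_isCompact (isCompact_closedBall 0 1)).mul_continuousOn hg.continuousOn
      (isCompact_closedBall 0 1)).mono_set ball_subset_closedBall
  have h2 : IntegrableOn (fun x => f x * g x) (ball 0 1)ᶜ μ := by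
    refine (hfd.norm.const_mul M).mono'
      (hf.aestronglyMeasurable.mul hg.aestronglyMeasurable).restrict ?_
    filter_upwards [ae_restrict_mem measurableSet_ball.compl] with x hx
    have hx1 : 1 ≤ ‖x‖ := by simpa using hx
    rw [norm_mul, norm_mul, norm_of_nonneg (show 0 ≤ (‖x‖ ^ b)⁻¹ by positivity), mul_left_comm]
    exact mul_le_mul_of_nonneg_left (hgd x hx1) (norm_nonneg _)
  rw [← integrableOn_univ, ← union_compl_self (ball (0 : E) 1)]
  exact h1.union h2

lemma exists_bubble_le (x : EuclideanSpace ℝ (Fin (k + 6))) (hδ : 0 < δ) (j : ℕ) :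
    ∃ M, ∀ y, 1 ≤ ‖y‖ → |(‖x - y‖ ^ 2 + δ ^ 2) ^ (-(j : ℝ) / 2)| ≤ M * (‖y‖ ^ j)⁻¹ := by
  set M := 2 + 2 * ‖x‖ ^ 2 / δ ^ 2 with hM
  have hM0 : 0 < M := by positivity
  refine ⟨M ^ ((j : ℝ) / 2), fun y hy => ?_⟩
  have hy0 : 0 < ‖y‖ := one_pos.trans_le hy
  have h1 : ‖y‖ ^ 2 / M ≤ ‖x - y‖ ^ 2 + δ ^ 2 := by
    rw [div_le_iff₀ hM0]
    have h2 : ‖y‖ ≤ ‖x - y‖ + ‖x‖ := by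
      rw [norm_sub_rev]
      exact norm_le_norm_sub_add y x
    have h3 : ‖y‖ ^ 2 ≤ 2 * ‖x - y‖ ^ 2 + 2 * ‖x‖ ^ 2 := by
      nlinarith [sq_nonneg (‖x - y‖ - ‖x‖), norm_nonneg (x - y), norm_nonneg x]
    have e : (‖x - y‖ ^ 2 + δ ^ 2) * M = 2 * ‖x - y‖ ^ 2 + 2 * ‖x‖ ^ 2 +
        (2 * δ ^ 2 + ‖x - y‖ ^ 2 * (2 * ‖x‖ ^ 2 / δ ^ 2)) := by
      rw [hM]
      field_simp
      ring
    rw [e]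
    have : 0 ≤ 2 * δ ^ 2 + ‖x - y‖ ^ 2 * (2 * ‖x‖ ^ 2 / δ ^ 2) := by positivity
    linarith
  rw [abs_of_nonneg (by positivity), neg_div, rpow_neg (by positivity)]
  have h4 := rpow_le_rpow (by positivity) h1 (show 0 ≤ (j : ℝ) / 2 by positivity)
  rw [div_rpow (by positivity) hM0.le, ← rpow_natCast ‖y‖ 2, ← rpow_mul hy0.le, Nat.cast_ofNat,
    mul_div_cancel₀ _ (two_ne_zero), rpow_natCast] at h4
  have h5 : 0 < M ^ ((j : ℝ) / 2) := by positivity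
  have h6 : 0 < ‖y‖ ^ j / M ^ ((j : ℝ) / 2) := by positivity
  calc _ ≤ (‖y‖ ^ j / M ^ ((j : ℝ) / 2))⁻¹ := inv_anti₀ h6 h4
    _ = _ := by rw [inv_div, div_eq_mul_inv]

lemma bubble_const_pos (hk : k ≠ 0) {a : ℝ} (ha : a = -k / 2) :
    0 < 64 * (a * (a - 1) * (a - 2) * (a - 3) * (a - 4) * (a - 5)) := by
  have hk' : (0 : ℝ) < k := by positivity
  have e : 64 * (a * (a - 1) * (a - 2) * (a - 3) * (a - 4) * (a - 5)) =
      64 * ((-a) * (1 - a) * (2 - a) * (3 - a) * (4 - a) * (5 - a)) := by ring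
  rw [e, ha]
  have h : ∀ m : ℝ, 0 ≤ m → 0 < m - -k / 2 := fun m hm => by linarith
  have h0 : 0 < -(-(k : ℝ) / 2) := by linarith
  have := h 1 (by norm_num)
  have := h 2 (by norm_num)
  have := h 3 (by norm_num)
  have := h 4 (by norm_num)
  have := h 5 (by norm_num)
  positivity

/-- The distributional equation tested against the standard bubbles. -/
lemma IsPuncturedSolution.integral_mul_bubble (hu : IsPuncturedSolution k p c u) (hk : k ≠ 0)
    (hp : p * k = k + 12) (hc : 0 < c) {a : ℝ} (ha : a = -k / 2)
    (x : EuclideanSpace ℝ (Fin (k + 6))) (hδ : 0 < δ) :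
    Integrable (fun y => u y * (‖x - y‖ ^ 2 + δ ^ 2) ^ (a - 6)) ∧
    Integrable (fun y => u y ^ p * (‖x - y‖ ^ 2 + δ ^ 2) ^ a) ∧
    64 * (a * (a - 1) * (a - 2) * (a - 3) * (a - 4) * (a - 5)) * δ ^ 6 *
      ∫ y, u y * (‖x - y‖ ^ 2 + δ ^ 2) ^ (a - 6) =
      c * ∫ y, u y ^ p * (‖x - y‖ ^ 2 + δ ^ 2) ^ a := by
  have hle6 : (6 : WithTop ℕ∞) ≤ ∞ := WithTop.coe_le_coe.2 (le_top : (6 : ℕ∞) ≤ ⊤)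
  set γ := 64 * (a * (a - 1) * (a - 2) * (a - 3) * (a - 4) * (a - 5)) with hγ
  set Φ : EuclideanSpace ℝ (Fin (k + 6)) → ℝ := fun y => (‖x - y‖ ^ 2 + δ ^ 2) ^ a with hΦ
  set T := trilap (stdVec (k + 6)) with hT
  have hTΦ : T Φ = fun y => -γ * δ ^ 6 * (‖x - y‖ ^ 2 + δ ^ 2) ^ (a - 6) :=
    trilap_bubble rfl x hδ ha
  have hΦC : ContDiff ℝ ∞ Φ := contDiff_bubble x hδ a
  have hloc := hu.locallyIntegrable hk hp hc
  have hlocp := hu.locallyIntegrable_rpow hk hp hc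
  obtain ⟨A, hA⟩ := hu.exists_shell_bound_self hk hp hc
  obtain ⟨B, hB⟩ := hu.exists_shell_bound hk hp hc
  have hdec := integrableOn_mul_inv_pow_of_shell_bound (b := k + 6) (by omega)
    (fun x hx => (hu.pos x hx).le) hA
  have hdecp := integrableOn_mul_inv_pow_of_shell_bound (b := k) (by omega) hu.rpow_nonneg hB
  have hI : Integrable (fun y => u y * (‖x - y‖ ^ 2 + δ ^ 2) ^ (a - 6)) := by
    obtain ⟨M, hM⟩ := exists_bubble_le x hδ (k + 12)
    have e : -((k + 12 : ℕ) : ℝ) / 2 = a - 6 := by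
      rw [ha]
      push_cast
      ring
    rw [e] at hM
    have hM0 : 0 ≤ M := by
      obtain ⟨y, hy⟩ := exists_norm_eq (EuclideanSpace ℝ (Fin (k + 6))) zero_le_one
      simpa [hy] using (abs_nonneg _).trans (hM y hy.ge)
    refine integrable_mul_of_decay (M := M) hloc hdec
      (contDiff_bubble (m := 0) x hδ _).continuous fun y hy => (hM y hy).trans ?_
    gcongr
    norm_num
  have hIp : Integrable (fun y => u y ^ p * Φ y) := by
    obtain ⟨M, hM⟩ := exists_bubble_le x hδ k
    rw [← ha] at hM
    exact integrable_mul_of_decay hlocp hdecp hΦC.continuous hM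
  refine ⟨hI, hIp, ?_⟩
  let θ : ContDiffBump (0 : EuclideanSpace ℝ (Fin (k + 6))) := ⟨1, 2, by norm_num, by norm_num⟩
  let D : Set (ℝ × EuclideanSpace ℝ (Fin (k + 6))) := {q | 0 < ‖q.1 • x - q.2‖ ^ 2 + (q.1 * δ) ^ 2}
  let G : ℝ × EuclideanSpace ℝ (Fin (k + 6)) → ℝ :=
    fun q => θ q.2 * (‖q.1 • x - q.2‖ ^ 2 + (q.1 * δ) ^ 2) ^ a
  have hbase : ContDiff ℝ ∞ fun q : ℝ × EuclideanSpace ℝ (Fin (k + 6)) =>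
      ‖q.1 • x - q.2‖ ^ 2 + (q.1 * δ) ^ 2 :=
    (((contDiff_fst.smul contDiff_const).sub contDiff_snd).norm_sq ℝ).add
      ((contDiff_fst.mul contDiff_const).pow 2)
  have hD : IsOpen D := isOpen_lt continuous_const hbase.continuous
  have hG : ContDiffOn ℝ ∞ G D := (θ.contDiff.comp contDiff_snd).contDiffOn.mul
    (hbase.contDiffOn.rpow_const_of_ne fun q hq => ne_of_gt hq)
  have hKD : Icc (0 : ℝ) 1 ×ˢ (closedBall (0 : EuclideanSpace ℝ (Fin (k + 6))) 2 \ ball 0 1) ⊆ D := by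
    rintro ⟨t, z⟩ ⟨ht, -, hz⟩
    have hz1 : 1 ≤ ‖z‖ := by simpa using hz
    change 0 < ‖t • x - z‖ ^ 2 + (t * δ) ^ 2
    rcases eq_or_ne t 0 with rfl | h
    · simp only [zero_smul, zero_sub, norm_neg]
      positivity
    · positivity
  obtain ⟨C, hC, hb⟩ := exists_trilap_slice_bound hD hG
    (isCompact_Icc.prod ((isCompact_closedBall 0 2).diff isOpen_ball)) hKD (stdVec (k + 6))
  set t : ℕ → ℝ := fun m => 1 / ((m : ℝ) + 1) with ht
  have ht0 : ∀ m, 0 < t m := fun m => by positivity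
  have ht1 : ∀ m, t m ≤ 1 := fun m =>
    div_le_one_of_le₀ (by linarith [m.cast_nonneg (α := ℝ)]) (by positivity)
  have htlim : Tendsto t atTop (𝓝 0) := tendsto_one_div_add_atTop_nhds_zero_nat
  have htnorm : ∀ m (y : EuclideanSpace ℝ (Fin (k + 6))), ‖t m • y‖ = t m * ‖y‖ := fun m y => by
    rw [norm_smul, norm_of_nonneg (ht0 m).le]
  have htev : ∀ y : EuclideanSpace ℝ (Fin (k + 6)), ∀ᶠ m in atTop, ‖t m • y‖ < 1 := fun y => by
    have : Tendsto (fun m => t m * ‖y‖) atTop (𝓝 0) := by simpa using htlim.mul_const ‖y‖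
    filter_upwards [this.eventually (eventually_lt_nhds one_pos)] with m hm
    rwa [htnorm]
  set Ψ : ℕ → EuclideanSpace ℝ (Fin (k + 6)) → ℝ := fun m y => θ (t m • y) * Φ y with hΨ
  have hθ1 : ∀ {z : EuclideanSpace ℝ (Fin (k + 6))}, ‖z‖ < 1 → θ z = 1 := fun {z} hz =>
    θ.one_of_mem_closedBall (mem_closedBall_zero_iff.2 hz.le)
  have hθ0 : ∀ {z : EuclideanSpace ℝ (Fin (k + 6))}, 2 < ‖z‖ → θ z = 0 := fun {z} hz =>
    θ.zero_of_le_dist (by simpa [θ] using hz.le)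
  have hΨC : ∀ m, ContDiff ℝ ∞ (Ψ m) := fun m =>
    (θ.contDiff.comp (contDiff_const_smul _)).mul hΦC
  have hΨc : ∀ m, HasCompactSupport (Ψ m) := fun m =>
    (θ.hasCompactSupport.comp_smul (ht0 m).ne').mul_right
  have hweak := fun m => hu.integral_mul_trilap hk hp hc (hΨC m) (hΨc m)
  have hTcont : ∀ m, Continuous (T (Ψ m)) := fun m => ContDiff.continuous (𝕜 := ℝ) (n := 0)
    (((hΨC m).of_le hle6).trilap (m := 0) (m' := 6) (by norm_num) _)
  have hTeq : ∀ m y, ‖t m • y‖ < 1 → T (Ψ m) y = T Φ y := fun m y hy => by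
    have : Ψ m =ᶠ[𝓝 y] Φ := by
      filter_upwards [(continuous_const_smul (t m)).norm.continuousAt.eventually
        (gt_mem_nhds hy)] with z hz
      simp only [hΨ, hθ1 hz, one_mul]
    exact (this.trilap _).eq_of_nhds
  have hTzero : ∀ m y, 2 < ‖t m • y‖ → T (Ψ m) y = 0 := fun m y hy => by
    have : Ψ m =ᶠ[𝓝 y] fun _ => 0 := by
      filter_upwards [(continuous_const_smul (t m)).norm.continuousAt.eventually
        (lt_mem_nhds hy)] with z hz
      simp only [hΨ, hθ0 hz, zero_mul]
    refine image_eq_zero_of_notMem_tsupport fun h => ?_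
    exact notMem_tsupport_iff_eventuallyEq.2 this (tsupport_trilap_subset _ _ h)
  have hTmid : ∀ m y, 1 ≤ ‖t m • y‖ → ‖t m • y‖ ≤ 2 →
      |T (Ψ m) y| ≤ C * 2 ^ (k + 6) * (‖y‖ ^ (k + 6))⁻¹ := fun m y h1 h2 => by
    have e : Ψ m = fun y => t m ^ k * (fun z => (fun w => G (t m, w)) (t m • z)) y := by
      funext y
      have e1 : ‖t m • x - t m • y‖ ^ 2 + (t m * δ) ^ 2 = t m ^ 2 * (‖x - y‖ ^ 2 + δ ^ 2) := by
        rw [← smul_sub, htnorm]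
        ring
      have e2 : (t m ^ 2) ^ a = (t m ^ k)⁻¹ := by
        rw [ha, ← rpow_natCast (t m) 2, ← rpow_mul (ht0 m).le, ← rpow_natCast (t m) k,
          ← rpow_neg (ht0 m).le]
        congr 1
        push_cast
        ring
      have := (ht0 m).ne'
      simp only [hΨ, G, hΦ]
      rw [e1, mul_rpow (by positivity) (by positivity), e2]
      field_simp
    rw [e, hT, trilap_const_mul, trilap_comp_smul _ (fun w => G (t m, w)), abs_mul, abs_mul,
      abs_of_nonneg (pow_nonneg (ht0 m).le k), abs_of_nonneg (pow_nonneg (ht0 m).le 6)]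
    have h3 := hb (t m) (t m • y) ⟨⟨(ht0 m).le, ht1 m⟩, by simpa using h2, by simpa using h1⟩
    rw [htnorm] at h1 h2
    have hy : 0 < ‖y‖ := pos_of_mul_pos_right (one_pos.trans_le h1) (ht0 m).le
    have h4 : t m ≤ 2 * ‖y‖⁻¹ := by
      rwa [← div_eq_mul_inv, le_div_iff₀ hy]
    have htm := (ht0 m).le
    calc _ ≤ t m ^ k * (t m ^ 6 * C) := by gcongr
      _ = C * t m ^ (k + 6) := by ring
      _ ≤ C * (2 * ‖y‖⁻¹) ^ (k + 6) := by gcongr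
      _ = _ := by rw [mul_pow, inv_pow, mul_assoc]
  have hL : Tendsto (fun m => ∫ y, u y * T (Ψ m) y) atTop (𝓝 (∫ y, u y * T Φ y)) := by
    refine tendsto_integral_of_dominated_convergence
      (fun y => ‖u y * T Φ y‖ + (ball 0 1)ᶜ.indicator
        (fun y => C * 2 ^ (k + 6) * (u y * (‖y‖ ^ (k + 6))⁻¹)) y)
      (fun m => (hloc.integrable_smul_right_of_hasCompactSupport (hTcont m)
        ((hΨc m).trilap _)).aestronglyMeasurable) (Integrable.add ?_
          ((integrable_indicator_iff measurableSet_ball.compl).2 (hdec.const_mul _))) (fun m => ?_)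
      (Eventually.of_forall fun y => ?_)
    · refine ((hI.const_mul (-γ * δ ^ 6)).congr (Eventually.of_forall fun y => ?_)).norm
      simp only [hTΦ]
      ring
    · filter_upwards [ae_ne_zero k] with y hy
      have huy := (hu.pos y hy).le
      have hind : 0 ≤ (ball 0 1)ᶜ.indicator
          (fun y => C * 2 ^ (k + 6) * (u y * (‖y‖ ^ (k + 6))⁻¹)) y := by
        by_cases h : y ∈ (ball (0 : EuclideanSpace ℝ (Fin (k + 6))) 1)ᶜ
        · rw [indicator_of_mem h]
          positivity
        · rw [indicator_of_notMem h]
      rcases lt_or_ge ‖t m • y‖ 1 with h1 | h1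
      · rw [hTeq m y h1]
        linarith
      rcases lt_or_ge 2 ‖t m • y‖ with h2 | h2
      · rw [hTzero m y h2, mul_zero, norm_zero]
        positivity
      · have hy1 : y ∈ (ball (0 : EuclideanSpace ℝ (Fin (k + 6))) 1)ᶜ := by
          rw [mem_compl_iff, mem_ball_zero_iff, not_lt]
          rw [htnorm] at h1
          exact h1.trans (mul_le_of_le_one_left (norm_nonneg y) (ht1 m))
        rw [indicator_of_mem hy1, norm_mul, norm_of_nonneg huy]
        refine le_add_of_nonneg_of_le (norm_nonneg _) ?_
        rw [mul_left_comm]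
        exact mul_le_mul_of_nonneg_left (hTmid m y h1 h2) huy
    · refine tendsto_const_nhds.congr' ?_
      filter_upwards [htev y] with m hm
      rw [hTeq m y hm]
  have hR : Tendsto (fun m => ∫ y, u y ^ p * Ψ m y) atTop (𝓝 (∫ y, u y ^ p * Φ y)) := by
    refine tendsto_integral_of_dominated_convergence (fun y => ‖u y ^ p * Φ y‖) (fun m =>
      (hlocp.integrable_smul_right_of_hasCompactSupport (hΨC m).continuous
        (hΨc m)).aestronglyMeasurable) hIp.norm (fun m => Eventually.of_forall fun y => ?_)
      (Eventually.of_forall fun y => ?_)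
    · have e : u y ^ p * Ψ m y = θ (t m • y) * (u y ^ p * Φ y) := by
        simp only [hΨ]
        ring
      rw [e, norm_mul, norm_of_nonneg θ.nonneg]
      exact mul_le_of_le_one_left (norm_nonneg _) θ.le_one
    · refine tendsto_const_nhds.congr' ?_
      filter_upwards [htev y] with m hm
      simp only [hΨ, hθ1 hm, one_mul]
  have hlim : ∫ y, u y * T Φ y = -(c * ∫ y, u y ^ p * Φ y) := by
    refine tendsto_nhds_unique hL ?_
    simp_rw [hT, hweak]
    exact (hR.const_mul c).neg
  have e : ∫ y, u y * T Φ y = -(γ * δ ^ 6 * ∫ y, u y * (‖x - y‖ ^ 2 + δ ^ 2) ^ (a - 6)) := by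
    rw [← integral_const_mul, ← integral_neg]
    congr 1 with y
    rw [hTΦ]
    ring
  rw [e] at hlim
  exact neg_injective hlim

end Bubble

section Representation

variable {k : ℕ} {p c δ : ℝ} {u : EuclideanSpace ℝ (Fin (k + 6)) → ℝ}

lemma integrable_and_integral_eq_of_monotone {α : Type*} [MeasurableSpace α] {μ : Measure α}
    {f : ℕ → α → ℝ} {F : α → ℝ} {L : ℝ} (hf : ∀ m, Integrable (f m) μ)
    (h0 : ∀ m, 0 ≤ᵐ[μ] f m) (hmono : ∀ᵐ x ∂μ, Monotone fun m => f m x)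
    (hlim : ∀ᵐ x ∂μ, Tendsto (fun m => f m x) atTop (𝓝 (F x)))
    (hL : Tendsto (fun m => ∫ x, f m x ∂μ) atTop (𝓝 L)) :
    Integrable F μ ∧ ∫ x, F x ∂μ = L := by
  have hF : Integrable F μ := by
    refine ⟨aestronglyMeasurable_of_tendsto_ae _ (fun m => (hf m).aestronglyMeasurable) hlim, ?_⟩
    have h1 : ∫⁻ x, ‖F x‖ₑ ∂μ ≤ liminf (fun m => ∫⁻ x, ‖f m x‖ₑ ∂μ) atTop := by
      rw [lintegral_congr_ae (hlim.mono fun x hx => hx.enorm.liminf_eq.symm)]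
      exact lintegral_liminf_le' fun m => (hf m).aestronglyMeasurable.enorm
    have h2 : ∀ m, ∫⁻ x, ‖f m x‖ₑ ∂μ = ENNReal.ofReal (∫ x, f m x ∂μ) := fun m => by
      rw [ofReal_integral_eq_lintegral_ofReal (hf m) (h0 m)]
      exact lintegral_congr_ae ((h0 m).mono fun x hx => Real.enorm_of_nonneg hx)
    simp_rw [h2] at h1
    rw [(ENNReal.tendsto_ofReal hL).liminf_eq] at h1
    exact h1.trans_lt ENNReal.ofReal_lt_top
  exact ⟨hF, tendsto_nhds_unique
    (integral_tendsto_of_tendsto_of_monotone hf hF hmono hlim) hL⟩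

lemma integrable_bubble {a : ℝ} (ha : a = -k / 2) :
    Integrable fun z : EuclideanSpace ℝ (Fin (k + 6)) => (1 + ‖z‖ ^ 2) ^ (a - 6) := by
  have := integrable_rpow_neg_one_add_norm_sq (E := EuclideanSpace ℝ (Fin (k + 6)))
    (μ := volume) (r := k + 12) (by
      rw [finrank_euclideanSpace, Fintype.card_fin]
      push_cast
      linarith)
  rwa [show -((k : ℝ) + 12) / 2 = a - 6 by rw [ha]; ring] at this

lemma integral_bubble_pos {a : ℝ} (ha : a = -k / 2) :
    0 < ∫ z : EuclideanSpace ℝ (Fin (k + 6)), (1 + ‖z‖ ^ 2) ^ (a - 6) := by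
  rw [integral_pos_iff_support_of_nonneg (fun z => by positivity) (integrable_bubble ha)]
  have : Function.support (fun z : EuclideanSpace ℝ (Fin (k + 6)) =>
      (1 + ‖z‖ ^ 2 : ℝ) ^ (a - 6)) = univ :=
    eq_univ_of_forall fun z => (show (0 : ℝ) < (1 + ‖z‖ ^ 2) ^ (a - 6) by positivity).ne'
  rw [this]
  exact isOpen_univ.measure_pos _ univ_nonempty

lemma tendsto_norm_pow_mul_bubble {a : ℝ} (ha : a = -k / 2) :
    Tendsto (fun z : EuclideanSpace ℝ (Fin (k + 6)) => ‖z‖ ^ (k + 6) * (1 + ‖z‖ ^ 2) ^ (a - 6))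
      (Bornology.cobounded _) (𝓝 0) := by
  obtain ⟨M, hM⟩ := exists_bubble_le (0 : EuclideanSpace ℝ (Fin (k + 6))) one_pos (k + 12)
  have h1 : Tendsto (fun z : EuclideanSpace ℝ (Fin (k + 6)) => M * (‖z‖ ^ 6)⁻¹)
      (Bornology.cobounded _) (𝓝 0) := by
    simpa using (((tendsto_pow_atTop (n := 6) (α := ℝ) (by norm_num)).comp
      (tendsto_norm_cobounded_atTop (E := EuclideanSpace ℝ (Fin (k + 6))))).inv_tendsto_atTop).const_mul M
  refine squeeze_zero' (Eventually.of_forall fun z => by positivity) ?_ h1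
  filter_upwards [tendsto_norm_cobounded_atTop.eventually (eventually_ge_atTop 1)] with z hz
  have h2 := (le_abs_self _).trans (hM z hz)
  rw [show -((k + 12 : ℕ) : ℝ) / 2 = a - 6 by rw [ha]; push_cast; ring, zero_sub, norm_neg,
    one_pow, add_comm] at h2
  have hz0 : 0 < ‖z‖ := one_pos.trans_le hz
  calc _ ≤ ‖z‖ ^ (k + 6) * (M * (‖z‖ ^ (k + 12))⁻¹) := by gcongr
    _ = _ := by
      rw [pow_add, pow_add _ k 12]
      field_simp

lemma rescaled_bubble {a : ℝ} (ha : a = -k / 2) (hδ : 0 < δ)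
    (z : EuclideanSpace ℝ (Fin (k + 6))) :
    δ ^ 6 * (‖z‖ ^ 2 + δ ^ 2) ^ (a - 6) =
      δ⁻¹ ^ (k + 6) * (1 + ‖δ⁻¹ • z‖ ^ 2) ^ (a - 6) := by
  have e1 : ‖z‖ ^ 2 + δ ^ 2 = δ ^ 2 * (1 + ‖δ⁻¹ • z‖ ^ 2) := by
    rw [norm_smul, norm_of_nonneg (inv_nonneg.2 hδ.le)]
    field_simp
    ring
  have e2 : (δ ^ 2) ^ (a - 6) = (δ ^ (k + 12))⁻¹ := by
    rw [ha, ← rpow_natCast δ 2, ← rpow_mul hδ.le, ← rpow_natCast δ (k + 12), ← rpow_neg hδ.le]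
    congr 1
    push_cast
    ring
  rw [e1, mul_rpow (by positivity) (by positivity), e2, ← mul_assoc, pow_add, pow_add, inv_pow,
    inv_pow]
  field_simp

/-- Rescaled bubbles form an approximate identity. -/
lemma IsPuncturedSolution.tendsto_integral_bubble (hu : IsPuncturedSolution k p c u) (hk : k ≠ 0)
    (hp : p * k = k + 12) (hc : 0 < c) {a : ℝ} (ha : a = -k / 2)
    {x : EuclideanSpace ℝ (Fin (k + 6))} (hx : x ≠ 0) {δ : ℕ → ℝ} (hδ : ∀ m, 0 < δ m)
    (hlim : Tendsto δ atTop (𝓝 0)) :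
    Tendsto (fun m => δ m ^ 6 * ∫ y, u y * (‖x - y‖ ^ 2 + δ m ^ 2) ^ (a - 6)) atTop
      (𝓝 ((∫ z : EuclideanSpace ℝ (Fin (k + 6)), (1 + ‖z‖ ^ 2) ^ (a - 6)) * u x)) := by
  set κ := ∫ z : EuclideanSpace ℝ (Fin (k + 6)), (1 + ‖z‖ ^ 2) ^ (a - 6) with hκ
  have hκ0 : 0 < κ := integral_bubble_pos ha
  have hI := fun {ε : ℝ} (hε : 0 < ε) => (hu.integral_mul_bubble hk hp hc ha x hε).1
  have hone := hI one_pos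
  have hcont : ContinuousAt ((ball x 1).indicator u) x := by
    have h1 : (ball x 1).indicator u =ᶠ[𝓝 x] u := by
      filter_upwards [ball_mem_nhds x one_pos] with y hy
      rw [indicator_of_mem hy]
    exact (hu.continuousOn.continuousAt (isOpen_compl_singleton.mem_nhds hx)).congr h1.symm
  have hg : Integrable ((ball x 1).indicator u) :=
    (integrable_indicator_iff measurableSet_ball).2 (((hu.locallyIntegrable hk hp
      hc).integrableOn_isCompact (isCompact_closedBall x 1)).mono_set ball_subset_closedBall)
  have hpeak := tendsto_integral_comp_smul_smul_of_integrable' (μ := volume)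
    (φ := fun z : EuclideanSpace ℝ (Fin (k + 6)) => κ⁻¹ * (1 + ‖z‖ ^ 2) ^ (a - 6))
    (fun z => by positivity)
    (by rw [integral_const_mul, ← hκ, inv_mul_cancel₀ hκ0.ne'])
    (by
      rw [finrank_euclideanSpace, Fintype.card_fin]
      simpa [mul_left_comm] using (tendsto_norm_pow_mul_bubble ha).const_mul κ⁻¹) hg hcont
  rw [finrank_euclideanSpace, Fintype.card_fin, indicator_of_mem (mem_ball_self one_pos)] at hpeak
  have hinv : Tendsto (fun m => (δ m)⁻¹) atTop atTop :=
    tendsto_inv_nhdsGT_zero.comp (tendsto_nhdsWithin_iff.2 ⟨hlim, Eventually.of_forall hδ⟩)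
  have hnear : Tendsto (fun m => δ m ^ 6 * ∫ y in ball x 1,
      u y * (‖x - y‖ ^ 2 + δ m ^ 2) ^ (a - 6)) atTop (𝓝 (κ * u x)) := by
    refine ((hpeak.comp hinv).const_mul κ).congr fun m => ?_
    rw [Function.comp_apply, ← integral_const_mul, ← integral_const_mul,
      ← integral_indicator measurableSet_ball]
    congr 1 with y
    by_cases hy : y ∈ ball x 1
    · rw [indicator_of_mem hy, indicator_of_mem hy, mul_left_comm _ (u y), rescaled_bubble ha (hδ m),
        smul_eq_mul]
      field_simp
    · rw [indicator_of_notMem hy, indicator_of_notMem hy, smul_zero, mul_zero]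
  have hfar : Tendsto (fun m => δ m ^ 6 * ∫ y in (ball x 1)ᶜ,
      u y * (‖x - y‖ ^ 2 + δ m ^ 2) ^ (a - 6)) atTop (𝓝 0) := by
    have ha6 : a - 6 ≤ 0 := by
      have : (0 : ℝ) ≤ k := k.cast_nonneg
      rw [ha]
      linarith
    have hbd : ∀ m, ∀ᵐ y ∂volume.restrict (ball x 1)ᶜ,
        u y * (‖x - y‖ ^ 2 + δ m ^ 2) ^ (a - 6) ≤
          (1 / 2) ^ (a - 6) * (u y * (‖x - y‖ ^ 2 + 1 ^ 2) ^ (a - 6)) := fun m => by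
      filter_upwards [ae_restrict_mem measurableSet_ball.compl, ae_restrict_of_ae (ae_ne_zero k)]
        with y hy hy0
      have hy1 : 1 ≤ ‖x - y‖ := by simpa [dist_eq_norm, norm_sub_rev] using hy
      have huy := (hu.pos y hy0).le
      rw [mul_left_comm, ← mul_rpow (by norm_num) (by positivity)]
      refine mul_le_mul_of_nonneg_left (rpow_le_rpow_of_nonpos (by positivity) ?_ ha6) huy
      nlinarith [sq_nonneg (δ m)]
    refine squeeze_zero (g := fun m => δ m ^ 6 * ∫ y in (ball x 1)ᶜ,
      (1 / 2) ^ (a - 6) * (u y * (‖x - y‖ ^ 2 + 1 ^ 2) ^ (a - 6))) (fun m => ?_) (fun m => ?_) ?_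
    · have := (hδ m).le
      refine mul_nonneg (by positivity) (integral_nonneg_of_ae (ae_restrict_of_ae
        ((ae_ne_zero k).mono fun y hy => ?_)))
      have := (hu.pos y hy).le
      simp only [Pi.zero_apply]
      positivity
    · have := (hδ m).le
      exact mul_le_mul_of_nonneg_left (integral_mono_ae (hI (hδ m)).integrableOn
        (hone.integrableOn.const_mul _) (hbd m)) (by positivity)
    · simpa using (hlim.pow 6).mul_const _
  have := hnear.add hfar
  rw [add_zero] at this
  refine this.congr fun m => ?_
  rw [← mul_add, integral_add_compl measurableSet_ball (hI (hδ m))]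

lemma IsPuncturedSolution.exists_integral_representation (hu : IsPuncturedSolution k p c u)
    (hk : k ≠ 0) (hp : p * k = k + 12) (hc : 0 < c) : ∃ C, 0 < C ∧ ∀ x ≠ 0,
      Integrable (fun y => (‖x - y‖ ^ k)⁻¹ * u y ^ p) ∧
      u x = C * ∫ y, (‖x - y‖ ^ k)⁻¹ * u y ^ p := by
  obtain ⟨a, ha⟩ : ∃ a : ℝ, a = -k / 2 := ⟨_, rfl⟩
  have hγ := bubble_const_pos hk ha
  set γ := 64 * (a * (a - 1) * (a - 2) * (a - 3) * (a - 4) * (a - 5)) with hγdef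
  set κ := ∫ z : EuclideanSpace ℝ (Fin (k + 6)), (1 + ‖z‖ ^ 2) ^ (a - 6) with hκdef
  have hκ : 0 < κ := integral_bubble_pos ha
  refine ⟨c / (γ * κ), by positivity, fun x hx => ?_⟩
  set δ : ℕ → ℝ := fun m => 1 / ((m : ℝ) + 1) with hδdef
  have hδ : ∀ m, 0 < δ m := fun m => by positivity
  have hδlim : Tendsto δ atTop (𝓝 0) := tendsto_one_div_add_atTop_nhds_zero_nat
  have hmain := fun m => hu.integral_mul_bubble hk hp hc ha x (hδ m)
  have ha0 : a ≤ 0 := by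
    have : (0 : ℝ) ≤ k := k.cast_nonneg
    rw [ha]
    linarith
  have hlim : Tendsto (fun m => ∫ y, u y ^ p * (‖x - y‖ ^ 2 + δ m ^ 2) ^ a) atTop
      (𝓝 (γ / c * (κ * u x))) := by
    refine ((hu.tendsto_integral_bubble hk hp hc ha hx hδ hδlim).const_mul (γ / c)).congr
      fun m => ?_
    have := (hmain m).2.2
    rw [div_mul_eq_mul_div, ← mul_assoc, this, mul_div_cancel_left₀ _ hc.ne']
  have key : Integrable (fun y => (‖x - y‖ ^ k)⁻¹ * u y ^ p) ∧
      ∫ y, (‖x - y‖ ^ k)⁻¹ * u y ^ p = γ / c * (κ * u x) := by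
    refine integrable_and_integral_eq_of_monotone (fun m => (hmain m).2.1)
      (fun m => (ae_ne_zero k).mono fun y hy => ?_) ((ae_ne_zero k).mono fun y hy => ?_) ?_ hlim
    · have := hu.rpow_nonneg y hy
      simp only [Pi.zero_apply]
      positivity
    · intro i j hij
      refine mul_le_mul_of_nonneg_left (rpow_le_rpow_of_nonpos (bubble_pos x y (hδ j)) ?_ ha0)
        (hu.rpow_nonneg y hy)
      have h3 : δ j ≤ δ i := by
        simp only [hδdef]
        gcongr
      have := (hδ j).le
      gcongr
    · filter_upwards [compl_mem_ae_iff.2 (measure_singleton x)] with y hy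
      have hxy : 0 < ‖x - y‖ := norm_pos_iff.2 (sub_ne_zero.2 fun h => hy h.symm)
      have e : (‖x - y‖ ^ 2) ^ a = (‖x - y‖ ^ k)⁻¹ := by
        rw [ha, ← rpow_natCast _ 2, ← rpow_mul hxy.le, ← rpow_natCast _ k, ← rpow_neg hxy.le]
        congr 1
        push_cast
        ring
      rw [mul_comm, ← e]
      have h4 : Tendsto (fun m => ‖x - y‖ ^ 2 + δ m ^ 2) atTop (𝓝 (‖x - y‖ ^ 2)) := by
        simpa using (hδlim.pow 2).const_add (‖x - y‖ ^ 2)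
      exact (h4.rpow_const (Or.inl (by positivity))).const_mul _
  refine ⟨key.1, ?_⟩
  rw [key.2]
  field_simp

end Representation

end

section Symmetry

open MeasureTheory

variable {k : ℕ} {p c : ℝ} {u : EuclideanSpace ℝ (Fin (k + 6)) → ℝ}

lemma IsPuncturedSolution.exists_isRieszSolution (hu : IsPuncturedSolution k p c u) (hk : k ≠ 0)
    (hp : p * k = k + 12) (hc : 0 < c) :
    ∃ C, 0 < C ∧ IsRieszSolution k p C (Function.update u 0 1) := by
  obtain ⟨C, hC, h⟩ := hu.exists_integral_representation hk hp hc
  have hae : ∀ x, (fun z => (‖x - z‖ ^ k)⁻¹ * u z ^ p) =ᵐ[volume]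
      fun z => (‖x - z‖ ^ k)⁻¹ * Function.update u 0 1 z ^ p := fun x => by
    filter_upwards [ae_ne_zero k] with z hz
    rw [Function.update_of_ne hz]
  refine ⟨C, hC, fun x => ?_, hu.continuousOn.congr fun x hx => Function.update_of_ne hx _ _,
    fun x hx => (h x hx).1.congr (hae x), fun x hx => ?_⟩
  · rcases eq_or_ne x 0 with rfl | hx
    · simp
    · rw [Function.update_of_ne hx]
      exact hu.pos x hx
  · rw [Function.update_of_ne hx, (h x hx).2, integral_congr_ae (hae x)]

lemma IsPuncturedSolution.eq_of_norm_eq (hu : IsPuncturedSolution k p c u) (hk : k ≠ 0)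
    (hp : p * k = k + 12) (hc : 0 < c)
    (hsing : ∀ M ε : ℝ, 0 < ε → ∃ x, x ≠ 0 ∧ ‖x‖ < ε ∧ M < u x)
    {x y : EuclideanSpace ℝ (Fin (k + 6))} (hx : x ≠ 0) (hy : y ≠ 0) (hxy : ‖x‖ = ‖y‖) :
    u x = u y := by
  obtain ⟨C, hC, hv⟩ := hu.exists_isRieszSolution hk hp hc
  have hs : ∀ M ε : ℝ, 0 < ε → ∃ x, x ≠ 0 ∧ ‖x‖ < ε ∧ M < Function.update u 0 1 x :=
    fun M ε hε => by
      obtain ⟨z, hz, h1, h2⟩ := hsing M ε hε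
      exact ⟨z, hz, h1, by rwa [Function.update_of_ne hz]⟩
  have hE : Module.finrank ℝ (EuclideanSpace ℝ (Fin (k + 6))) = k + 6 := by simp
  have hp1 := (one_lt_of_mul_eq hk hp).le
  have h1 := hv.le_of_norm_eq hE hp hp1 hC hs hx hy hxy
  have h2 := hv.le_of_norm_eq hE hp hp1 hC hs hy hx hxy.symm
  rw [Function.update_of_ne hx, Function.update_of_ne hy] at h1 h2
  exact le_antisymm h1 h2

end Symmetry

lemma cN_pos {n : ℕ} (hn : 7 ≤ n) : 0 < cN n := by
  have h : (7 : ℝ) ≤ n := by exact_mod_cast hn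
  have e : cN n = (n : ℝ) * (n - 6) * ((n ^ 2 - 4) * (n ^ 2 - 16)) / 64 := by
    rw [cN]
    ring
  have h1 : (0 : ℝ) < n - 6 := by linarith
  have h2 : (0 : ℝ) < n ^ 2 - 4 := by nlinarith
  have h3 : (0 : ℝ) < n ^ 2 - 16 := by nlinarith
  rw [e]
  positivity

theorem radial_symmetry_of_singular_solutions
    (n : ℕ) (hn : 7 ≤ n)
    (u : EuclideanSpace ℝ (Fin n) → ℝ)
    (hpos : ∀ x : EuclideanSpace ℝ (Fin n), x ≠ 0 → 0 < u x)
    (hreg : ContDiffOn ℝ 6 u {x : EuclideanSpace ℝ (Fin n) | x ≠ 0})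
    (hpde : ∀ x : EuclideanSpace ℝ (Fin n), x ≠ 0 →
      -(laplacian (laplacian (laplacian u)) x) = cN n * u x ^ (((n : ℝ) + 6) / ((n : ℝ) - 6)))
    (hsing : ∀ M : ℝ, ∀ ε : ℝ, 0 < ε → ∃ x : EuclideanSpace ℝ (Fin n),
      x ≠ 0 ∧ ‖x‖ < ε ∧ M < u x) :
    ∀ x y : EuclideanSpace ℝ (Fin n), x ≠ 0 → y ≠ 0 → ‖x‖ = ‖y‖ → u x = u y := by
  have hc := cN_pos hn
  obtain ⟨k, rfl⟩ := Nat.exists_eq_add_of_le' (show 6 ≤ n by omega)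
  have hk : k ≠ 0 := by omega
  have hu : IsPuncturedSolution k ((((k + 6 : ℕ) : ℝ) + 6) / (((k + 6 : ℕ) : ℝ) - 6))
      (cN (k + 6)) u :=
    ⟨hpos, hreg, fun x hx => by
      rw [← hpde x hx, neg_neg,
        laplacian_laplacian_laplacian_eq_trilap isOpen_compl_singleton hreg hx]⟩
  intro x y hx hy hxy
  refine hu.eq_of_norm_eq hk ?_ hc hsing hx hy hxy
  have hk' : (k : ℝ) ≠ 0 := Nat.cast_ne_zero.2 hk
  push_cast
  rw [add_sub_cancel_right]
  field_simp
  ring
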